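/- arXiv:1501.07341 — 2 statements merged into one kernel-verified Lean document; each statement's English description precedes it below -/
import Mathlib

section
/- Let γ : I → R^m (m ≥ 3) be smooth with γ'(t₀), γ''(t₀), γ'''(t₀) linearly independent. Then the tangent surface f(t,s) = γ(t) + s γ'(t) is, as a germ at (t₀, 0), diffeomorphic to the cuspidal edge (u,w) ↦ (u, w², w³, 0, …, 0). -/
/-- `f` (as a germ at `p`) is diffeomorphic to `g` (as a germ at `q`): there are
diffeomorphism-germs `σ` of the source and `τ` of the target with `τ ∘ f = g ∘ σ`. -/
def LocallyDiffeomorphic {E F : Type*} [NormedAddCommGroup E] [NormedSpace ℝ E]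
    [NormedAddCommGroup F] [NormedSpace ℝ F]
    (f : E → F) (p : E) (g : E → F) (q : E) : Prop :=
  ∃ (σ σi : E → E) (τ τi : F → F) (U : Set E) (W : Set F),
    IsOpen U ∧ p ∈ U ∧ IsOpen W ∧ f p ∈ W ∧
    ContDiffOn ℝ (⊤ : ℕ∞) σ U ∧ ContDiffOn ℝ (⊤ : ℕ∞) τ W ∧
    (∀ x ∈ U, σi (σ x) = x) ∧ (∀ y ∈ W, τi (τ y) = y) ∧
    ContDiffOn ℝ (⊤ : ℕ∞) σi (σ '' U) ∧ ContDiffOn ℝ (⊤ : ℕ∞) τi (τ '' W) ∧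
    σ p = q ∧ f '' U ⊆ W ∧ ∀ x ∈ U, τ (f x) = g (σ x)

open scoped ContDiff Topology
open MeasureTheory


/-- Smooth functions on the line all of whose derivatives are bounded. -/
def HasBoundedDerivs (θ : ℝ → ℝ) : Prop :=
  ContDiff ℝ ∞ θ ∧ ∀ n : ℕ, ∃ C, ∀ y, ‖iteratedDeriv n θ y‖ ≤ C

theorem HasBoundedDerivs.deriv {θ : ℝ → ℝ} (h : HasBoundedDerivs θ) :
    HasBoundedDerivs (deriv θ) := by
  refine ⟨(contDiff_infty_iff_deriv.1 h.1).2, fun n => ?_⟩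
  obtain ⟨C, hC⟩ := h.2 (n + 1)
  exact ⟨C, fun y => by simpa [iteratedDeriv_succ'] using hC y⟩

/-- The function `y ↦ cos √y` on `[0, ∞)` has a smooth extension to the line. -/
theorem exists_contDiff_sq_eq_cos :
    ∃ c : ℝ → ℝ, ContDiff ℝ ∞ c ∧ ∀ z, c (z ^ 2) = Real.cos z := by
  set a : ℕ → ℝ := fun n => (-1) ^ n / (2 * n).factorial with ha
  have hr : (FormalMultilinearSeries.ofScalars ℝ a).radius = ⊤ := by
    apply FormalMultilinearSeries.ofScalars_radius_eq_top_of_tendsto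
    · filter_upwards with n
      simp only [ha]; positivity
    · have hq : ∀ n : ℕ, ‖a n.succ‖ / ‖a n‖ = 1 / ((2 * n + 2 : ℝ) * (2 * n + 1)) := by
        intro n
        have h1 : (2 * n.succ).factorial = (2 * n + 2) * ((2 * n + 1) * (2 * n).factorial) := by
          rw [show 2 * n.succ = 2 * n + 1 + 1 by lia, Nat.factorial_succ, Nat.factorial_succ]
        have h2 : ((2 * n).factorial : ℝ) ≠ 0 := by positivity
        simp only [ha, norm_div, norm_pow, norm_neg, norm_one, one_pow, h1, Nat.cast_mul,
          RCLike.norm_natCast, norm_mul]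
        push_cast
        field_simp
      simp only [hq]
      refine squeeze_zero (fun n => by positivity) (fun n => ?_)
        tendsto_one_div_add_atTop_nhds_zero_nat
      have : (0 : ℝ) ≤ n := by positivity
      apply one_div_le_one_div_of_le (by positivity)
      nlinarith
  have hball := (FormalMultilinearSeries.ofScalars ℝ a).hasFPowerSeriesOnBall
    (by rw [hr]; exact ENNReal.zero_lt_top)
  rw [hr] at hball
  refine ⟨(FormalMultilinearSeries.ofScalars ℝ a).sum, ?_, fun z => ?_⟩
  · have := hball.analyticOnNhd
    rw [Metric.eball_top] at this
    exact this.contDiff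
  · have h := hball.hasSum (y := z ^ 2) (by simp)
    rw [zero_add] at h
    refine h.unique ?_
    convert! Real.hasSum_cos z using 1
    ext n
    simp [ha, pow_mul]
    ring

theorem hasDerivAt_iteratedDeriv {θ : ℝ → ℝ} (h : ContDiff ℝ ∞ θ) (n : ℕ) (y : ℝ) :
    HasDerivAt (iteratedDeriv n θ) (iteratedDeriv (n + 1) θ y) y := by
  rw [iteratedDeriv_succ]
  exact (h.differentiable_iteratedDeriv n (by exact_mod_cast ENat.natCast_lt_top n) y).hasDerivAt

/-- The derivatives of the differential equation `θ + 2 θ' + 4 y θ'' = 0` satisfied by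
`cos √y`. -/
theorem iteratedDeriv_cos_sqrt_ode {θ : ℝ → ℝ} (h : ContDiff ℝ ∞ θ)
    (hcos : ∀ z, θ (z ^ 2) = Real.cos z) (n : ℕ) {y : ℝ} (hy : 0 ≤ y) :
    iteratedDeriv n θ y + (4 * n + 2) * iteratedDeriv (n + 1) θ y
      + 4 * y * iteratedDeriv (n + 2) θ y = 0 := by
  induction n generalizing y with
  | zero =>
    have h1 : ∀ z, iteratedDeriv 1 θ (z ^ 2) * (2 * z) = -Real.sin z := fun z => by
      have hd := (hasDerivAt_iteratedDeriv h 0 (z ^ 2)).comp z (hasDerivAt_pow 2 z)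
      have : (iteratedDeriv 0 θ ∘ fun z : ℝ => z ^ 2) = Real.cos := by
        ext z; simp [hcos]
      rw [this] at hd
      simpa using hd.unique (Real.hasDerivAt_cos z)
    have h2 : ∀ z, iteratedDeriv 2 θ (z ^ 2) * (2 * z) * (2 * z) + iteratedDeriv 1 θ (z ^ 2) * 2
        = -Real.cos z := fun z => by
      have hd := ((hasDerivAt_iteratedDeriv h 1 (z ^ 2)).comp z (hasDerivAt_pow 2 z)).mul
        ((hasDerivAt_id z).const_mul 2)
      have : ((iteratedDeriv 1 θ ∘ fun z : ℝ => z ^ 2) * fun z => 2 * id z)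
          = fun z => - Real.sin z := by
        ext z; simp only [Pi.mul_apply, Function.comp_apply, id, h1]
      rw [this] at hd
      simpa using hd.unique (Real.hasDerivAt_sin z).neg
    have h3 := h2 √y
    rw [← hcos, Real.sq_sqrt hy] at h3
    have h4 := Real.sq_sqrt hy
    simp only [iteratedDeriv_zero, Nat.cast_zero, zero_add]
    linear_combination h3 - 4 * iteratedDeriv 2 θ y * h4
  | succ n ih =>
    have hcont : ∀ k, Continuous (iteratedDeriv k θ) := fun k =>
      h.continuous_iteratedDeriv k (by exact_mod_cast le_top)
    have hpos : ∀ x ∈ Set.Ioi (0 : ℝ), iteratedDeriv (n + 1) θ x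
        + (4 * (n + 1 : ℕ) + 2) * iteratedDeriv (n + 1 + 1) θ x
        + 4 * x * iteratedDeriv (n + 1 + 2) θ x = 0 := by
      intro x hx
      have hd := ((hasDerivAt_iteratedDeriv h n x).add
        ((hasDerivAt_iteratedDeriv h (n + 1) x).const_mul (4 * n + 2 : ℝ))).add
        (((hasDerivAt_id x).const_mul 4).mul (hasDerivAt_iteratedDeriv h (n + 2) x))
      have he : (fun _ => (0 : ℝ)) =ᶠ[𝓝 x] (iteratedDeriv n θ
          + fun y => (4 * n + 2 : ℝ) * iteratedDeriv (n + 1) θ y)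
          + (fun y => 4 * id y) * iteratedDeriv (n + 2) θ := by
        filter_upwards [Ioi_mem_nhds hx] with y hy
        simpa using (ih (le_of_lt hy)).symm
      have := (hd.congr_of_eventuallyEq he).unique (hasDerivAt_const x (0 : ℝ))
      simp only [id, Nat.cast_add, Nat.cast_one] at this ⊢
      linear_combination this
    have hcl : IsClosed {x : ℝ | iteratedDeriv (n + 1) θ x
        + (4 * (n + 1 : ℕ) + 2) * iteratedDeriv (n + 1 + 1) θ x
        + 4 * x * iteratedDeriv (n + 1 + 2) θ x = 0} := by
      refine isClosed_eq ?_ continuous_const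
      have := hcont (n + 1); have := hcont (n + 1 + 1); have := hcont (n + 1 + 2)
      fun_prop
    have := closure_minimal hpos hcl
    rw [closure_Ioi] at this
    exact this hy

/-- An extension of `y ↦ cos √y` to the line with all derivatives bounded. -/
theorem exists_hasBoundedDerivs_sq_eq_cos :
    ∃ θ : ℝ → ℝ, HasBoundedDerivs θ ∧ ∀ z, θ (z ^ 2) = Real.cos z := by
  obtain ⟨c, hc, hcos⟩ := exists_contDiff_sq_eq_cos
  set θ : ℝ → ℝ := fun y => Real.smoothTransition (y + 1) * c y with hθ
  have hsm : ContDiff ℝ ∞ θ :=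
    (Real.smoothTransition.contDiff.comp (contDiff_id.add contDiff_const)).mul hc
  have hθcos : ∀ z, θ (z ^ 2) = Real.cos z := fun z => by
    simp [hθ, hcos, Real.smoothTransition.one_of_one_le (show 1 ≤ z ^ 2 + 1 by nlinarith)]
  refine ⟨θ, ⟨hsm, ?_⟩, hθcos⟩
  have hneg : ∀ n, ∀ y < -1, iteratedDeriv n θ y = 0 := fun n y hy => by
    have he : θ =ᶠ[𝓝 y] fun _ => 0 := by
      filter_upwards [Iio_mem_nhds hy] with x hx
      have hx : x < -1 := hx
      simp [hθ, Real.smoothTransition.zero_of_nonpos (show x + 1 ≤ 0 by linarith)]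
    rw [he.iteratedDeriv_eq n]
    simp
  have hmid : ∀ n, ∃ C, ∀ y ∈ Set.Icc (-1 : ℝ) 1, ‖iteratedDeriv n θ y‖ ≤ C := fun n =>
    isCompact_Icc.exists_bound_of_continuousOn
      (hsm.continuous_iteratedDeriv n (by exact_mod_cast le_top)).continuousOn
  have hall : ∀ n, (∃ C, ∀ y, 1 ≤ y → ‖iteratedDeriv n θ y‖ ≤ C) →
      ∃ C, ∀ y, ‖iteratedDeriv n θ y‖ ≤ C := by
    rintro n ⟨C, hC⟩
    obtain ⟨D, hD⟩ := hmid n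
    refine ⟨max C D, fun y => ?_⟩
    have hD0 : 0 ≤ D := (norm_nonneg _).trans (hD 0 (by simp))
    rcases lt_or_ge y (-1) with h | h
    · rw [hneg n y h]; simp [hD0]
    · rcases le_total y 1 with h1 | h1
      · exact (hD y ⟨h, h1⟩).trans (le_max_right _ _)
      · exact (hC y h1).trans (le_max_left _ _)
  have h0 : ∃ C, ∀ y, 1 ≤ y → ‖iteratedDeriv 0 θ y‖ ≤ C := by
    refine ⟨1, fun y hy => ?_⟩
    have := hθcos √y
    rw [Real.sq_sqrt (by linarith)] at this
    rw [iteratedDeriv_zero, this]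
    exact Real.abs_cos_le_one _
  have h1 : ∃ C, ∀ y, 1 ≤ y → ‖iteratedDeriv 1 θ y‖ ≤ C := by
    refine ⟨1, fun y hy => ?_⟩
    have hd := (hasDerivAt_iteratedDeriv hsm 0 (√y ^ 2)).comp √y (hasDerivAt_pow 2 √y)
    have he : (iteratedDeriv 0 θ ∘ fun z : ℝ => z ^ 2) = Real.cos := by
      ext z; simp [hθcos]
    rw [he] at hd
    have h2 := hd.unique (Real.hasDerivAt_cos √y)
    rw [Real.sq_sqrt (by linarith)] at h2
    have h3 : 1 ≤ √y := Real.one_le_sqrt.2 hy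
    have h4 : ‖iteratedDeriv 1 θ y‖ * (2 * √y) ≤ 1 := by
      have := congrArg norm h2
      simp only [norm_mul, norm_neg, Real.norm_eq_abs] at this ⊢
      have h5 := Real.abs_sin_le_one √y
      rw [← this] at h5
      simpa [abs_of_nonneg (show 0 ≤ √y by positivity)] using h5
    nlinarith [norm_nonneg (iteratedDeriv 1 θ y)]
  have key : ∀ n, (∃ C, ∀ y, 1 ≤ y → ‖iteratedDeriv n θ y‖ ≤ C) ∧
      ∃ C, ∀ y, 1 ≤ y → ‖iteratedDeriv (n + 1) θ y‖ ≤ C := by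
    intro n
    induction n with
    | zero => exact ⟨h0, h1⟩
    | succ n ih =>
      refine ⟨ih.2, ?_⟩
      obtain ⟨⟨A, hA⟩, ⟨B, hB⟩⟩ := ih
      refine ⟨A + (4 * n + 2) * B, fun y hy => ?_⟩
      have hode := iteratedDeriv_cos_sqrt_ode hsm hθcos n (y := y) (by linarith)
      have hA := hA y hy
      have hB := hB y hy
      have h2 : 4 * y * ‖iteratedDeriv (n + 2) θ y‖ ≤ A + (4 * n + 2) * B := by
        have : ‖4 * y * iteratedDeriv (n + 2) θ y‖
            = ‖iteratedDeriv n θ y + (4 * n + 2) * iteratedDeriv (n + 1) θ y‖ := by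
          rw [← norm_neg]; congr 1; linear_combination -hode
        rw [norm_mul, Real.norm_of_nonneg (show 0 ≤ 4 * y by linarith)] at this
        rw [this]
        refine (norm_add_le _ _).trans (add_le_add hA ?_)
        rw [norm_mul, Real.norm_of_nonneg (show (0 : ℝ) ≤ 4 * n + 2 by positivity)]
        gcongr
      refine le_trans ?_ h2
      have := norm_nonneg (iteratedDeriv (n + 2) θ y)
      show ‖iteratedDeriv (n + 2) θ y‖ ≤ _
      nlinarith
  exact fun n => hall n (key n).1

/-- All moments of `ψ` are absolutely convergent. -/
def HasIntegrableMoments (ψ : ℝ → ℂ) : Prop :=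
  ∀ k : ℕ, Integrable fun ξ : ℝ => (ξ : ℂ) ^ k * ψ ξ

/-- The oscillatory integral `∫ ξ ^ k ψ(ξ) exp(iξu) θ(xξ²) dξ` as a function of `(u, x)`. -/
noncomputable def oscIntegral (ψ : ℝ → ℂ) (k : ℕ) (θ : ℝ → ℝ) (p : ℝ × ℝ) : ℂ :=
  ∫ ξ : ℝ, (ξ : ℂ) ^ k * ψ ξ * (Complex.exp (ξ * p.1 * Complex.I) * (θ (p.2 * ξ ^ 2) : ℝ))

theorem norm_exp_ofReal_mul_ofReal_mul_I (a b : ℝ) : ‖Complex.exp (a * b * Complex.I)‖ = 1 := by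
  rw [← Complex.ofReal_mul, Complex.norm_exp_ofReal_mul_I]

theorem integrable_oscIntegral {ψ : ℝ → ℂ} (hψ : HasIntegrableMoments ψ) (k : ℕ) {θ : ℝ → ℝ}
    (hθ : HasBoundedDerivs θ) (p : ℝ × ℝ) :
    Integrable fun ξ : ℝ => (ξ : ℂ) ^ k * ψ ξ *
      (Complex.exp (ξ * p.1 * Complex.I) * (θ (p.2 * ξ ^ 2) : ℝ)) := by
  obtain ⟨C, hC⟩ := hθ.2 0
  have hc := hθ.1.continuous
  refine (hψ k).mul_bdd (c := C) (by fun_prop) (.of_forall fun ξ => ?_)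
  rw [norm_mul, norm_exp_ofReal_mul_ofReal_mul_I, one_mul, Complex.norm_real]
  exact hC _

/-- The real derivative of a function of two real variables with given partial derivatives. -/
noncomputable def partialsCLM (a b : ℂ) : ℝ × ℝ →L[ℝ] ℂ :=
  (ContinuousLinearMap.fst ℝ ℝ ℝ).smulRight a + (ContinuousLinearMap.snd ℝ ℝ ℝ).smulRight b

theorem norm_partialsCLM_le (a b : ℂ) : ‖partialsCLM a b‖ ≤ ‖a‖ + ‖b‖ := by
  refine (norm_add_le _ _).trans (add_le_add ?_ ?_)
  · rw [ContinuousLinearMap.norm_smulRight_apply]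
    exact mul_le_of_le_one_left (norm_nonneg _) (ContinuousLinearMap.norm_fst_le ..)
  · rw [ContinuousLinearMap.norm_smulRight_apply]
    exact mul_le_of_le_one_left (norm_nonneg _) (ContinuousLinearMap.norm_snd_le ..)

theorem continuous_partialsCLM : Continuous fun q : ℂ × ℂ => partialsCLM q.1 q.2 := by
  unfold partialsCLM
  fun_prop

theorem hasFDerivAt_oscIntegral {ψ : ℝ → ℂ} (hψ : HasIntegrableMoments ψ) (k : ℕ) {θ : ℝ → ℝ}
    (hθ : HasBoundedDerivs θ) (p : ℝ × ℝ) :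
    HasFDerivAt (oscIntegral ψ k θ)
      (partialsCLM (Complex.I * oscIntegral ψ (k + 1) θ p) (oscIntegral ψ (k + 2) (deriv θ) p))
      p := by
  obtain ⟨C, hC⟩ := hθ.2 0
  obtain ⟨D, hD⟩ := hθ.deriv.2 0
  simp only [iteratedDeriv_zero] at hC hD
  set F' : ℝ × ℝ → ℝ → (ℝ × ℝ →L[ℝ] ℂ) := fun q ξ => partialsCLM
    (Complex.I * ((ξ : ℂ) ^ (k + 1) * ψ ξ *
      (Complex.exp (ξ * q.1 * Complex.I) * (θ (q.2 * ξ ^ 2) : ℝ))))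
    ((ξ : ℂ) ^ (k + 2) * ψ ξ *
      (Complex.exp (ξ * q.1 * Complex.I) * (deriv θ (q.2 * ξ ^ 2) : ℝ))) with hF'
  have i1 := (integrable_oscIntegral hψ (k + 1) hθ p).const_mul Complex.I
  have i2 := integrable_oscIntegral hψ (k + 2) hθ.deriv p
  have hint : ∫ ξ, F' p ξ = partialsCLM (Complex.I * oscIntegral ψ (k + 1) θ p)
      (oscIntegral ψ (k + 2) (deriv θ) p) := by
    have j1 := ((ContinuousLinearMap.smulRightL ℝ (ℝ × ℝ) ℂ)
      (ContinuousLinearMap.fst ℝ ℝ ℝ)).integral_comp_comm i1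
    have j2 := ((ContinuousLinearMap.smulRightL ℝ (ℝ × ℝ) ℂ)
      (ContinuousLinearMap.snd ℝ ℝ ℝ)).integral_comp_comm i2
    have k1 := ((ContinuousLinearMap.smulRightL ℝ (ℝ × ℝ) ℂ)
      (ContinuousLinearMap.fst ℝ ℝ ℝ)).integrable_comp i1
    have k2 := ((ContinuousLinearMap.smulRightL ℝ (ℝ × ℝ) ℂ)
      (ContinuousLinearMap.snd ℝ ℝ ℝ)).integrable_comp i2
    rw [integral_const_mul] at j1
    exact (integral_add k1 k2).trans (congrArg₂ (· + ·) j1 j2)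
  rw [← hint]
  refine hasFDerivAt_integral_of_dominated_of_fderiv_le (𝕜 := ℝ) (F' := F') (s := Set.univ)
    (bound := fun ξ : ℝ => ‖(ξ : ℂ) ^ (k + 1) * ψ ξ‖ * C + ‖(ξ : ℂ) ^ (k + 2) * ψ ξ‖ * D)
    Filter.univ_mem ?_ (integrable_oscIntegral hψ k hθ p) ?_ ?_ ?_ ?_
  · exact .of_forall fun q => (integrable_oscIntegral hψ k hθ q).1
  · have h := continuous_partialsCLM.comp_aestronglyMeasurable (i1.1.prodMk i2.1)
    exact h
  · refine .of_forall fun ξ q _ => (norm_partialsCLM_le _ _).trans (add_le_add ?_ ?_)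
    · rw [norm_mul, norm_mul, norm_mul (Complex.exp _), norm_exp_ofReal_mul_ofReal_mul_I,
        Complex.norm_I, one_mul, one_mul, Complex.norm_real]
      gcongr
      exact hC _
    · rw [norm_mul, norm_mul (Complex.exp _), norm_exp_ofReal_mul_ofReal_mul_I,
        one_mul, Complex.norm_real]
      gcongr
      exact hD _
  · exact ((hψ (k + 1)).norm.mul_const C).add ((hψ (k + 2)).norm.mul_const D)
  · refine .of_forall fun ξ q _ => ?_
    have e1 : HasFDerivAt (fun q : ℝ × ℝ => (ξ : ℂ) * q.1 * Complex.I)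
        ((ContinuousLinearMap.fst ℝ ℝ ℝ).smulRight ((ξ : ℂ) * Complex.I)) q := by
      convert! ((ContinuousLinearMap.fst ℝ ℝ ℝ).smulRight ((ξ : ℂ) * Complex.I)).hasFDerivAt
        (x := q) using 1
      ext q
      simp
      ring
    have e2 : HasFDerivAt (fun q : ℝ × ℝ => q.2 * ξ ^ 2)
        ((ContinuousLinearMap.snd ℝ ℝ ℝ).smulRight (ξ ^ 2)) q := by
      convert! ((ContinuousLinearMap.snd ℝ ℝ ℝ).smulRight (ξ ^ 2)).hasFDerivAt
        (x := q) using 1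
    have e3 := (hθ.1.differentiable (by simp) (q.2 * ξ ^ 2)).hasDerivAt.ofReal_comp
    have e4 := e3.hasFDerivAt.comp q e2
    have e5 := (e1.cexp.mul e4).const_mul ((ξ : ℂ) ^ k * ψ ξ)
    refine e5.congr_fderiv ?_
    ext
    · simp [hF', partialsCLM]
      ring
    · simp [hF', partialsCLM]
      ring

theorem contDiff_oscIntegral {ψ : ℝ → ℂ} (hψ : HasIntegrableMoments ψ) (k : ℕ) {θ : ℝ → ℝ}
    (hθ : HasBoundedDerivs θ) : ContDiff ℝ ∞ (oscIntegral ψ k θ) := by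
  refine contDiff_infty.2 fun n => ?_
  induction n generalizing k θ with
  | zero =>
    exact contDiff_zero.2 (continuous_iff_continuousAt.2 fun p =>
      (hasFDerivAt_oscIntegral hψ k hθ p).continuousAt)
  | succ n ih =>
    refine contDiff_succ_iff_hasFDerivAt.2 ⟨_, ?_, hasFDerivAt_oscIntegral hψ k hθ⟩
    unfold partialsCLM
    have := ih (k + 1) hθ
    have := ih (k + 2) hθ.deriv
    fun_prop

/-- Fourier inversion for smooth compactly supported functions. -/
theorem exists_eq_integral_mul_exp {γ : ℝ → ℂ} (hγ : ContDiff ℝ ∞ γ) (hs : HasCompactSupport γ) :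
    ∃ ψ : ℝ → ℂ, HasIntegrableMoments ψ ∧
      ∀ t : ℝ, γ t = ∫ ξ : ℝ, ψ ξ * Complex.exp (ξ * t * Complex.I) := by
  set S := hs.toSchwartzMap hγ
  set F := FourierTransform.fourier S
  have hF : ∀ k, Integrable fun ξ : ℝ => (ξ : ℂ) ^ k * F ξ := fun k => by
    refine (F.integrable_pow_mul volume k).mono ?_ (.of_forall fun ξ => by simp)
    have := F.continuous
    fun_prop
  have hpi : (2 * Real.pi) ≠ 0 := by positivity
  refine ⟨fun ξ => ((2 * Real.pi : ℝ) : ℂ)⁻¹ * F (ξ / (2 * Real.pi)), fun k => ?_, fun t => ?_⟩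
  · have := ((hF k).comp_div hpi).const_mul (((2 * Real.pi : ℝ) : ℂ) ^ k * ((2 * Real.pi : ℝ) : ℂ)⁻¹)
    refine this.congr (.of_forall fun ξ => ?_)
    have hpi' : (Real.pi : ℂ) ≠ 0 := by exact_mod_cast Real.pi_ne_zero
    simp only [Complex.ofReal_div, Complex.ofReal_mul, div_pow]
    field_simp
  · have h1 : γ t = (FourierTransformInv.fourierInv F) t := by
      rw [show FourierTransformInv.fourierInv F = S from FourierTransform.fourierInv_fourier_eq S]
      rfl
    rw [h1, SchwartzMap.fourierInv_coe, Real.fourierInv_eq']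
    have h2 := Measure.integral_comp_div
      (fun v : ℝ => Complex.exp ((2 * Real.pi * inner ℝ v t : ℝ) * Complex.I) • F v) (2 * Real.pi)
    rw [abs_of_pos (by positivity)] at h2
    have hpi' : ((2 * Real.pi : ℝ) : ℂ) ≠ 0 := by exact_mod_cast hpi
    calc _ = ((2 * Real.pi : ℝ) : ℂ)⁻¹ * ((2 * Real.pi) •
          ∫ v : ℝ, Complex.exp ((2 * Real.pi * inner ℝ v t : ℝ) * Complex.I) • F v) := by
          rw [Complex.real_smul, inv_mul_cancel_left₀ hpi']
      _ = _ := by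
          rw [← h2, ← integral_const_mul]
          congr 1
          ext ξ
          have : 2 * Real.pi * inner ℝ (ξ / (2 * Real.pi)) t = ξ * t := by
            simp only [RCLike.inner_apply, conj_trivial]
            field_simp
          rw [this]
          simp only [smul_eq_mul, Complex.ofReal_mul]
          ring

theorem oscIntegral_apply_zero (ψ : ℝ → ℂ) (k : ℕ) (θ : ℝ → ℝ) (t : ℝ) :
    oscIntegral ψ k θ (t, 0) =
      (∫ ξ : ℝ, (ξ : ℂ) ^ k * ψ ξ * Complex.exp (ξ * t * Complex.I)) * (θ 0 : ℝ) := by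
  rw [← integral_mul_const]
  simp only [oscIntegral, zero_mul, mul_assoc]

theorem hasDerivAt_oscIntegral_left {ψ : ℝ → ℂ} (hψ : HasIntegrableMoments ψ) (k : ℕ)
    {θ : ℝ → ℝ} (hθ : HasBoundedDerivs θ) (t : ℝ) :
    HasDerivAt (fun t => oscIntegral ψ k θ (t, 0))
      (Complex.I * oscIntegral ψ (k + 1) θ (t, 0)) t := by
  have h := (hasFDerivAt_oscIntegral hψ k hθ (t, 0)).comp_hasDerivAt t
    ((hasDerivAt_id t).prodMk (hasDerivAt_const t (0 : ℝ)))
  simpa [partialsCLM, Function.comp_def] using h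

/-- Even and odd parts of `exp(-iz)(1 + iz)`, in terms of `θ(y) = cos √y`. -/
theorem exp_neg_mul_one_add_eq {θ : ℝ → ℝ} (hθ : ContDiff ℝ ∞ θ)
    (hcos : ∀ z, θ (z ^ 2) = Real.cos z) (z : ℝ) :
    Complex.exp (-(z * Complex.I)) * (1 + z * Complex.I) =
      (θ (z ^ 2) : ℝ) - 2 * z ^ 2 * (deriv θ (z ^ 2) : ℝ)
        - 4 * Complex.I * z ^ 3 * (deriv (deriv θ) (z ^ 2) : ℝ) := by
  have hsin : 2 * z * deriv θ (z ^ 2) = -Real.sin z := by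
    have hd := (hθ.differentiable (by simp) (z ^ 2)).hasDerivAt.comp z (hasDerivAt_pow 2 z)
    rw [show (θ ∘ fun z : ℝ => z ^ 2) = Real.cos from funext hcos] at hd
    have := hd.unique (Real.hasDerivAt_cos z)
    rw [← this]
    simp
    ring
  have hode := iteratedDeriv_cos_sqrt_ode hθ hcos 0 (sq_nonneg z)
  have h2 : iteratedDeriv 2 θ = deriv (deriv θ) := by
    rw [iteratedDeriv_succ, iteratedDeriv_one]
  simp only [iteratedDeriv_zero, zero_add, iteratedDeriv_one, h2] at hode
  have hcos' := congrArg (fun x : ℝ => (x : ℂ)) (hcos z)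
  have hsin' := congrArg (fun x : ℝ => (x : ℂ)) hsin
  have hode' := congrArg (fun x : ℝ => (x : ℂ)) hode
  push_cast at hcos' hsin' hode'
  rw [← neg_mul, Complex.exp_mul_I, Complex.cos_neg, Complex.sin_neg]
  linear_combination (-1 - z * Complex.I) * hcos' + (z - Complex.I) * hsin' + z * Complex.I * hode'
    + (-z * Complex.sin z) * Complex.I_sq

/-- For a compactly supported smooth `γ`, the function `(u, s) ↦ γ(u - s) + s γ'(u - s)` has the
form `P(u, s²) + s³ R(u, s²)` with `P` and `R` smooth. -/
theorem exists_tangent_decomposition_of_hasCompactSupport {γ : ℝ → ℝ} (hγ : ContDiff ℝ ∞ γ)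
    (hs : HasCompactSupport γ) :
    ∃ P R : ℝ × ℝ → ℝ, ContDiff ℝ ∞ P ∧ ContDiff ℝ ∞ R ∧
      (∀ t s, γ t + s * deriv γ t = P (t + s, s ^ 2) + s ^ 3 * R (t + s, s ^ 2)) ∧
      (∀ t, HasFDerivAt P (deriv γ t • ContinuousLinearMap.fst ℝ ℝ ℝ
        - (iteratedDeriv 2 γ t / 2) • ContinuousLinearMap.snd ℝ ℝ ℝ) (t, 0)) ∧
      ∀ t, R (t, 0) = iteratedDeriv 3 γ t / 3 := by
  obtain ⟨ψ, hψ, hγψ⟩ := exists_eq_integral_mul_exp (γ := fun t => (γ t : ℂ))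
    (Complex.ofRealCLM.contDiff.comp hγ) (hs.comp_left (g := Complex.ofReal) rfl)
  obtain ⟨θ, hθ, hcos⟩ := exists_hasBoundedDerivs_sq_eq_cos
  have hθ0 : θ 0 = 1 := by simpa using hcos 0
  have hθ1 : deriv θ 0 = -1 / 2 := by
    have := iteratedDeriv_cos_sqrt_ode hθ.1 hcos 0 le_rfl
    simp [hθ0] at this
    linarith
  have hθ2 : deriv (deriv θ) 0 = 1 / 12 := by
    have := iteratedDeriv_cos_sqrt_ode hθ.1 hcos 1 le_rfl
    rw [iteratedDeriv_succ (n := 1), iteratedDeriv_one, hθ1] at this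
    simp at this
    linarith
  have hderiv : ∀ n t, iteratedDeriv n γ t = (Complex.I ^ n * oscIntegral ψ n θ (t, 0)).re := by
    intro n
    induction n with
    | zero =>
      intro t
      rw [oscIntegral_apply_zero, hθ0]
      simp only [pow_zero, one_mul, ← hγψ]
      simp
    | succ n ih =>
      intro t
      rw [iteratedDeriv_succ, funext ih]
      have h := Complex.reCLM.hasFDerivAt.comp_hasDerivAt t
        ((hasDerivAt_oscIntegral_left hψ n hθ t).const_mul (Complex.I ^ n))
      rw [pow_succ, mul_assoc]
      exact h.deriv
  have hsm0 := contDiff_oscIntegral hψ 0 hθ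
  have hsm2 := contDiff_oscIntegral hψ 2 hθ.deriv
  have hsm3 := contDiff_oscIntegral hψ 3 hθ.deriv.deriv
  have hone : ∀ t, deriv γ t = (Complex.I * oscIntegral ψ 1 θ (t, 0)).re := fun t => by
    rw [← iteratedDeriv_one, hderiv, pow_one]
  refine ⟨fun p => (oscIntegral ψ 0 θ p - 2 * (p.2 * oscIntegral ψ 2 (deriv θ) p)).re,
    fun p => (-4 * Complex.I * oscIntegral ψ 3 (deriv (deriv θ)) p).re, ?_, ?_, ?_, ?_, ?_⟩
  · refine Complex.reCLM.contDiff.comp (hsm0.sub (contDiff_const.mul (ContDiff.mul ?_ hsm2)))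
    exact Complex.ofRealCLM.contDiff.comp contDiff_snd
  · exact Complex.reCLM.contDiff.comp (contDiff_const.mul hsm3)
  · intro t s
    rw [hone, ← iteratedDeriv_zero (f := γ), hderiv, pow_zero, one_mul,
      ← Complex.re_ofReal_mul, ← Complex.add_re]
    have : s ^ 3 * (-4 * Complex.I * oscIntegral ψ 3 (deriv (deriv θ)) (t + s, s ^ 2)).re
        = (((s ^ 3 : ℝ) : ℂ) * (-4 * Complex.I * oscIntegral ψ 3 (deriv (deriv θ))
          (t + s, s ^ 2))).re := by
      rw [Complex.re_ofReal_mul]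
    rw [this, ← Complex.add_re]
    congr 1
    have a1 := integrable_oscIntegral hψ 0 hθ (t, 0)
    have a2 := (integrable_oscIntegral hψ 1 hθ (t, 0)).const_mul (s * Complex.I)
    have a3 := integrable_oscIntegral hψ 0 hθ (t + s, s ^ 2)
    have a4 := (integrable_oscIntegral hψ 2 hθ.deriv (t + s, s ^ 2)).const_mul (2 * (s : ℂ) ^ 2)
    have a5 := (integrable_oscIntegral hψ 3 hθ.deriv.deriv (t + s, s ^ 2)).const_mul
      ((s : ℂ) ^ 3 * (-4 * Complex.I))
    have e1 := integral_add a1 a2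
    have e2 := integral_add (a3.sub a4) a5
    have e3 := integral_sub a3 a4
    rw [integral_const_mul] at e1 e2 e3
    simp only [Pi.sub_apply] at e2
    rw [e3] at e2
    rw [← mul_assoc]
    refine (e1.symm.trans ?_).trans (e2.trans (by simp only [oscIntegral]; push_cast; ring))
    congr 1
    ext ξ
    have hz := exp_neg_mul_one_add_eq hθ.1 hcos (s * ξ)
    have hexp : Complex.exp (ξ * t * Complex.I) = Complex.exp (ξ * (t + s : ℝ) * Complex.I) *
        Complex.exp (-((s * ξ : ℝ) * Complex.I)) := by
      rw [← Complex.exp_add]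
      congr 1
      push_cast
      ring
    simp only [zero_mul, hθ0, hexp, ← mul_pow]
    push_cast at hz ⊢
    linear_combination ψ ξ * Complex.exp (ξ * (t + s) * Complex.I) * hz
  · intro t
    have b1 := hasFDerivAt_oscIntegral hψ 0 hθ (t, 0)
    have b2 := hasFDerivAt_oscIntegral hψ 2 hθ.deriv (t, 0)
    have b3 : HasFDerivAt (fun p : ℝ × ℝ => (p.2 : ℂ))
        (Complex.ofRealCLM.comp (ContinuousLinearMap.snd ℝ ℝ ℝ)) (t, 0) :=
      (Complex.ofRealCLM.comp (ContinuousLinearMap.snd ℝ ℝ ℝ)).hasFDerivAt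
    have b4 := Complex.reCLM.hasFDerivAt.comp (t, (0 : ℝ)) (b1.sub ((b3.mul b2).const_mul 2))
    have hrel : oscIntegral ψ 2 (deriv θ) (t, 0) = -(1 / 2) * oscIntegral ψ 2 θ (t, 0) := by
      simp only [oscIntegral_apply_zero, hθ0, hθ1]
      push_cast
      ring
    refine b4.congr_fderiv ?_
    rw [hone, hderiv, Complex.I_sq]
    ext
    · simp [partialsCLM]
    · simp [partialsCLM, hrel]
      ring
  · intro t
    have hrel : oscIntegral ψ 3 (deriv (deriv θ)) (t, 0) = 1 / 12 * oscIntegral ψ 3 θ (t, 0) := by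
      simp only [oscIntegral_apply_zero, hθ0, hθ2]
      push_cast
      ring
    simp only [hderiv, hrel, Complex.I_pow_three]
    simp
    ring

/-- Near `t₀`, the function `γ(t) + s γ'(t)` has the form `P(t + s, s²) + s³ R(t + s, s²)` with `P`
and `R` smooth. -/
theorem exists_tangent_decomposition {γ : ℝ → ℝ} (hγ : ContDiff ℝ ∞ γ) (t₀ : ℝ) :
    ∃ P R : ℝ × ℝ → ℝ, ContDiff ℝ ∞ P ∧ ContDiff ℝ ∞ R ∧
      (∀ᶠ t in 𝓝 t₀, ∀ s, γ t + s * deriv γ t = P (t + s, s ^ 2) + s ^ 3 * R (t + s, s ^ 2)) ∧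
      HasFDerivAt P (deriv γ t₀ • ContinuousLinearMap.fst ℝ ℝ ℝ
        - (iteratedDeriv 2 γ t₀ / 2) • ContinuousLinearMap.snd ℝ ℝ ℝ) (t₀, 0) ∧
      R (t₀, 0) = iteratedDeriv 3 γ t₀ / 3 := by
  let χ : ContDiffBump t₀ := default
  have he : (fun t => χ t * γ t) =ᶠ[𝓝 t₀] γ := by
    filter_upwards [χ.eventuallyEq_one] with t ht
    simp [ht]
  obtain ⟨P, R, hP, hR, hPR, hdP, hR0⟩ := exists_tangent_decomposition_of_hasCompactSupport
    (χ.contDiff.mul hγ) χ.hasCompactSupport.mul_right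
  refine ⟨P, R, hP, hR, ?_, ?_, ?_⟩
  · filter_upwards [he.eventuallyEq_nhds] with t ht s
    have h1 := hPR t s
    have h2 : χ t * γ t = γ t := ht.eq_of_nhds
    rwa [ht.deriv_eq, h2] at h1
  · rw [← he.deriv_eq, ← he.iteratedDeriv_eq 2]
    exact hdP t₀
  · rw [← he.iteratedDeriv_eq 3]
    exact hR0 t₀

/-- If `f = Φ ∘ g ∘ σ` near `p` with `σ` a diffeomorphism and `Φ` smooth with invertible derivative at
`g q`, then `f` and `g` are diffeomorphic germs. -/
theorem locallyDiffeomorphic_of_eventually_eq {E F : Type*} [NormedAddCommGroup E]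
    [NormedSpace ℝ E] [NormedAddCommGroup F] [NormedSpace ℝ F] [CompleteSpace F]
    {f g : E → F} {p q : E} {σ σi : E → E} {Φ : F → F} {Φ' : F ≃L[ℝ] F}
    (hσ : ContDiff ℝ ∞ σ) (hσi : ContDiff ℝ ∞ σi) (hσσi : Function.LeftInverse σi σ)
    (hσp : σ p = q) (hg : Continuous g) (hΦ : ContDiff ℝ ∞ Φ)
    (hΦ' : HasFDerivAt Φ (Φ' : F →L[ℝ] F) (g q)) (hf : ∀ᶠ x in 𝓝 p, f x = Φ (g (σ x))) :
    LocallyDiffeomorphic f p g q := by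
  subst hσp
  set e := hΦ.contDiffAt.toOpenPartialHomeomorph Φ hΦ' (by simp)
  have hecoe : ⇑e = Φ := rfl
  set S : Set F :=
    e.source ∩ (fderiv ℝ Φ) ⁻¹' Set.range ((↑) : (F ≃L[ℝ] F) → F →L[ℝ] F)
  have hSo : IsOpen S := e.open_source.inter
    ((ContinuousLinearEquiv.isOpen).preimage (hΦ.continuous_fderiv (by simp)))
  have hmem : g (σ p) ∈ S :=
    ⟨hΦ.contDiffAt.mem_toOpenPartialHomeomorph_source hΦ' (by simp), Φ', hΦ'.fderiv.symm⟩
  have hinv : ∀ y ∈ S, e.symm (Φ y) = y := fun y hy => e.left_inv hy.1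
  obtain ⟨V, hVf, hVo, hpV⟩ := mem_nhds_iff.1 hf
  refine ⟨σ, σi, e.symm, Φ, V ∩ (g ∘ σ) ⁻¹' S, Φ '' S,
    hVo.inter (hSo.preimage (hg.comp hσ.continuous)), ⟨hpV, hmem⟩,
    e.isOpen_image_of_subset_source hSo Set.inter_subset_left,
    ⟨_, hmem, (hVf hpV).symm⟩, hσ.contDiffOn, ?_, fun x _ => hσσi x, ?_,
    hσi.contDiffOn, hΦ.contDiffOn, rfl, ?_, ?_⟩
  · rintro _ ⟨y, hy, rfl⟩
    obtain ⟨L, hL⟩ := hy.2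
    refine (e.contDiffAt_symm (f₀' := L) (e.map_source hy.1) ?_ hΦ.contDiffAt).contDiffWithinAt
    rw [hecoe, hinv y hy, hL]
    exact (hΦ.differentiable (by simp) y).hasFDerivAt
  · rintro _ ⟨y, hy, rfl⟩
    rw [hinv y hy]
  · rintro _ ⟨x, hx, rfl⟩
    exact ⟨_, hx.2, (hVf hx.1).symm⟩
  · intro x hx
    rw [hVf hx.1]
    exact hinv _ hx.2

theorem Module.Basis.sumExtend_inl {K V ι : Type*} [DivisionRing K] [AddCommGroup V]
    [Module K V] {v : ι → V} (hv : LinearIndependent K v) (i : ι) :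
    Module.Basis.sumExtend hv (Sum.inl i) = v i := by
  simp only [Module.Basis.sumExtend, Module.Basis.reindex_apply]
  rw [Module.Basis.extend_apply_self]
  rfl

/-- Linear automorphisms act transitively on finite linearly independent families. -/
theorem LinearIndependent.exists_linearEquiv_apply_eq {K V ι : Type*} [Field K]
    [AddCommGroup V] [Module K V] [FiniteDimensional K V] [Finite ι] {v w : ι → V}
    (hv : LinearIndependent K v) (hw : LinearIndependent K w) :
    ∃ e : V ≃ₗ[K] V, ∀ i, e (v i) = w i := by
  let b := Module.Basis.sumExtend hv
  let c := Module.Basis.sumExtend hw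
  have hb := Module.Finite.finite_basis b
  have hc := Module.Finite.finite_basis c
  have hcard := (Module.finrank_eq_nat_card_basis b).symm.trans
    (Module.finrank_eq_nat_card_basis c)
  have := Finite.of_injective _ (Sum.inr_injective (α := ι) (β := Module.Basis.sumExtendIndex hv))
  have := Finite.of_injective _ (Sum.inr_injective (α := ι) (β := Module.Basis.sumExtendIndex hw))
  rw [Nat.card_sum, Nat.card_sum, Nat.add_left_cancel_iff] at hcard
  obtain ⟨s⟩ := Finite.card_eq.1 hcard
  refine ⟨b.equiv c (Equiv.sumCongr (Equiv.refl ι) s), fun i => ?_⟩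
  have h1 : b (Sum.inl i) = v i := Module.Basis.sumExtend_inl hv i
  have h2 : c (Sum.inl i) = w i := Module.Basis.sumExtend_inl hw i
  rw [← h1, Module.Basis.equiv_apply, ← h2]
  rfl

theorem iteratedDeriv_pi_apply {ι : Type*} [Fintype ι] {γ : ℝ → ι → ℝ} (hγ : ContDiff ℝ ∞ γ)
    (n : ℕ) (t : ℝ) (i : ι) :
    iteratedDeriv n γ t i = iteratedDeriv n (fun t => γ t i) t := by
  induction n generalizing t with
  | zero => simp
  | succ n ih =>
    have hd := (hγ.differentiable_iteratedDeriv n (by exact_mod_cast ENat.natCast_lt_top n)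
      t).hasDerivAt
    rw [iteratedDeriv_succ, iteratedDeriv_succ, ← funext ih]
    exact (hasDerivAt_pi.1 hd i).deriv.symm

/-- if `γ'(t₀), γ''(t₀), γ'''(t₀)` are linearly independent in `ℝ^m`
(`m ≥ 3`), then the tangent surface `f(t,s) = γ(t) + s γ'(t)`, as a germ at `(t₀,0)`,
is diffeomorphic to the cuspidal edge `(u,w) ↦ (u, w², w³, 0, …, 0)`. -/
theorem stmt10 (m : ℕ) (hm : 3 ≤ m) (γ : ℝ → Fin m → ℝ) (hγ : ContDiff ℝ (⊤ : ℕ∞) γ)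
    (t₀ : ℝ)
    (hindep : LinearIndependent ℝ
      ![deriv γ t₀, iteratedDeriv 2 γ t₀, iteratedDeriv 3 γ t₀])
    (f : ℝ × ℝ → Fin m → ℝ) (hf : f = fun p => γ p.1 + p.2 • deriv γ p.1)
    (g : ℝ × ℝ → Fin m → ℝ)
    (hg : g = fun (p : ℝ × ℝ) (i : Fin m) => if (i : ℕ) = 0 then p.1
      else if (i : ℕ) = 1 then p.2 ^ 2
      else if (i : ℕ) = 2 then p.2 ^ 3 else 0) :
    LocallyDiffeomorphic f (t₀, 0) g (0, 0) := by
  set i₀ : Fin m := ⟨0, by lia⟩ with hi₀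
  set i₁ : Fin m := ⟨1, by lia⟩ with hi₁
  set i₂ : Fin m := ⟨2, by lia⟩ with hi₂
  have hγi : ∀ i, ContDiff ℝ ∞ fun t => γ t i := contDiff_pi.1 hγ
  choose P R hP hR hPR hdP hR0 using fun i => exists_tangent_decomposition (hγi i) t₀
  obtain ⟨M, hM⟩ := LinearIndependent.exists_linearEquiv_apply_eq
    (v := ![Pi.single i₀ (1 : ℝ), Pi.single i₁ 1, Pi.single i₂ 1])
    (by
      have := (Pi.basisFun ℝ (Fin m)).linearIndependent.comp (Fin.castLE hm)
        (Fin.castLE_injective hm)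
      convert! this using 1
      ext k : 1
      fin_cases k <;> simp [hi₀, hi₁, hi₂] <;> rfl)
    (hindep.units_smul ![1, Units.mk0 (-1 / 2) (by norm_num), Units.mk0 (1 / 3) (by norm_num)])
  have hM0 : M (Pi.single i₀ 1) = deriv γ t₀ := by simpa using hM 0
  have hM1 : M (Pi.single i₁ 1) = (-1 / 2 : ℝ) • iteratedDeriv 2 γ t₀ := hM 1
  have hM2 : M (Pi.single i₂ 1) = (1 / 3 : ℝ) • iteratedDeriv 3 γ t₀ := hM 2
  have hd1 : ∀ t i, deriv (fun t => γ t i) t = deriv γ t i := fun t i => by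
    rw [← iteratedDeriv_one, ← iteratedDeriv_one, iteratedDeriv_pi_apply hγ]
  have hg0 : g (0, 0) = 0 := by
    ext i
    simp [hg]
  have hgM : ∀ u w, M (g (u, w)) = u • deriv γ t₀ - (w ^ 2 / 2) • iteratedDeriv 2 γ t₀
      + (w ^ 3 / 3) • iteratedDeriv 3 γ t₀ := fun u w => by
    have : g (u, w) = u • Pi.single i₀ 1 + w ^ 2 • Pi.single i₁ 1 + w ^ 3 • Pi.single i₂ 1 := by
      ext i
      simp only [hg, Pi.add_apply, Pi.smul_apply, Pi.single_apply, hi₀, hi₁, hi₂, Fin.ext_iff,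
        smul_eq_mul]
      split_ifs <;> first | lia | simp
    rw [this, map_add, map_add, map_smul, map_smul, map_smul, hM0, hM1, hM2]
    module
  set L : Fin m → (Fin m → ℝ) →L[ℝ] ℝ := fun i =>
    deriv γ t₀ i • ContinuousLinearMap.proj i₀
      - (iteratedDeriv 2 γ t₀ i / 2) • ContinuousLinearMap.proj i₁
      + (iteratedDeriv 3 γ t₀ i / 3) • ContinuousLinearMap.proj i₂ with hL
  set M' : (Fin m → ℝ) ≃L[ℝ] (Fin m → ℝ) := M.toContinuousLinearEquiv with hM'
  set Φ : (Fin m → ℝ) → Fin m → ℝ := fun y i => P i (t₀ + y i₀, y i₁)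
    + y i₂ * R i (t₀ + y i₀, y i₁) + (M' y i - L i y) with hΦ
  refine locallyDiffeomorphic_of_eventually_eq (σ := fun p => (p.1 + p.2 - t₀, p.2))
    (σi := fun p => (p.1 - p.2 + t₀, p.2)) (Φ := Φ) (Φ' := M') (by fun_prop) (by fun_prop)
    (fun p => Prod.ext (by ring) rfl) (by simp) ?_ ?_ ?_ ?_
  · rw [hg]
    refine continuous_pi fun i => ?_
    split_ifs <;> fun_prop
  · refine contDiff_pi.2 fun i => ?_
    have hq : ContDiff ℝ ∞ fun y : Fin m → ℝ => (t₀ + y i₀, y i₁) := by fun_prop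
    have h1 := (hP i).comp hq
    have h2 := (hR i).comp hq
    have h3 : ContDiff ℝ ∞ fun y : Fin m → ℝ => M' y i :=
      contDiff_pi.1 M'.contDiff i
    have h4 : ContDiff ℝ ∞ fun y : Fin m → ℝ => y i₂ := contDiff_apply ..
    exact (h1.add (h4.mul h2)).add (h3.sub (L i).contDiff)
  · rw [hg0]
    refine hasFDerivAt_pi'.2 fun i => ?_
    have hq : HasFDerivAt (fun y : Fin m → ℝ => (t₀ + y i₀, y i₁))
        ((ContinuousLinearMap.proj (R := ℝ) (φ := fun _ : Fin m => ℝ) i₀).prod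
          (ContinuousLinearMap.proj i₁)) 0 :=
      ((hasFDerivAt_apply i₀ _).const_add t₀).prodMk (hasFDerivAt_apply i₁ _)
    have hq0 : (t₀ + (0 : Fin m → ℝ) i₀, (0 : Fin m → ℝ) i₁) = (t₀, 0) := by simp
    have h1 := HasFDerivAt.comp (0 : Fin m → ℝ) (g := P i) (by rw [hq0]; exact hdP i) hq
    have h2 := HasFDerivAt.comp (0 : Fin m → ℝ) (g := R i) (by
      rw [hq0]; exact ((hR i).differentiable (by simp) _).hasFDerivAt) hq
    have h3 := (h1.add ((hasFDerivAt_apply i₂ (0 : Fin m → ℝ)).mul h2)).add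
      ((hasFDerivAt_pi'.1 M'.hasFDerivAt i).sub (L i).hasFDerivAt)
    refine h3.congr_fderiv ?_
    ext y
    simp [hL, hR0, hd1, iteratedDeriv_pi_apply hγ]
  · have hev : ∀ᶠ t in 𝓝 t₀, ∀ i s, γ t i + s * deriv (fun t => γ t i) t
        = P i (t + s, s ^ 2) + s ^ 3 * R i (t + s, s ^ 2) := Filter.eventually_all.2 hPR
    have hfst : Filter.Tendsto Prod.fst (𝓝 (t₀, (0 : ℝ))) (𝓝 t₀) := continuous_fst.continuousAt
    filter_upwards [hfst.eventually hev] with p hp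
    ext i
    have hgi : g (p.1 + p.2 - t₀, p.2) i₀ = p.1 + p.2 - t₀ ∧
        g (p.1 + p.2 - t₀, p.2) i₁ = p.2 ^ 2 ∧ g (p.1 + p.2 - t₀, p.2) i₂ = p.2 ^ 3 := by
      simp [hg, hi₀, hi₁, hi₂]
    have h1 := hp i p.2
    have h2 := congrFun (hgM (p.1 + p.2 - t₀) p.2) i
    simp only [hd1] at h1
    simp only [hf, hΦ, hgi, hM', LinearEquiv.coe_toContinuousLinearEquiv', h2, hL]
    simp [hgi, h1]
    ring
end

section
/- Let γ : I → R³ be smooth with γ'(t₀), γ''(t₀), γ'''(t₀) linearly dependent but γ'(t₀), γ''(t₀), γ''''(t₀) linearly independent. Then the tangent surface f(t,s) = γ(t) + sγ'(t), as a germ at (t₀,0), is diffeomorphic to the folded umbrella (u,t) ↦ (u, t² + ut, t⁴ + (2/3)u t³). -/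
open Set Filter Topology MeasureTheory
open scoped ContDiff

/-- A smooth function on the whole line extending `x ↦ cos √x`, cut off on the far left. -/
lemma exists_contDiff_cos_sqrt : ∃ D : ℝ → ℝ, ContDiff ℝ ∞ D ∧ (∀ x, D (x ^ 2) = Real.cos x) ∧
    ∀ x ≤ -2, D x = 0 := by
  set c : ℕ → ℝ := fun n => (-1) ^ n / (2 * n).factorial with hc
  have hrad : (FormalMultilinearSeries.ofScalars ℝ c).radius = ⊤ := by
    refine FormalMultilinearSeries.ofScalars_radius_eq_top_of_tendsto ℝ c
      (Eventually.of_forall fun n => by simp [hc, Nat.factorial_ne_zero]) ?_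
    refine squeeze_zero (g := fun n : ℕ => 1 / ((n : ℝ) + 1)) (fun n => by positivity) (fun n => ?_)
      tendsto_one_div_add_atTop_nhds_zero_nat
    have h1 : ((2 * (n + 1)).factorial : ℝ)
        = (2 * n + 2) * ((2 * n + 1) * (2 * n).factorial) := by
      rw [show 2 * (n + 1) = (2 * n + 1) + 1 by ring, Nat.factorial_succ, Nat.factorial_succ]
      push_cast; ring
    have h2 : (0 : ℝ) < (2 * n).factorial := by positivity
    simp only [hc, Nat.succ_eq_add_one, norm_div, norm_pow, norm_neg, norm_one, one_pow,
      Real.norm_natCast, h1]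
    rw [Real.norm_of_nonneg (by positivity)]
    field_simp
    nlinarith [Nat.cast_nonneg (α := ℝ) n]
  have han : ContDiff ℝ ∞ (FormalMultilinearSeries.ofScalars ℝ c).sum := by
    have h := (FormalMultilinearSeries.ofScalars ℝ c).hasFPowerSeriesOnBall (by simp [hrad])
    rw [hrad] at h
    refine AnalyticOnNhd.contDiff ?_
    have := h.analyticOnNhd
    rwa [Metric.eball_top] at this
  refine ⟨fun x => Real.smoothTransition (x + 2) * (FormalMultilinearSeries.ofScalars ℝ c).sum x,
    ((Real.smoothTransition.contDiff (n := ⊤)).comp (by fun_prop)).mul han, fun x => ?_,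
    fun x hx => ?_⟩
  · beta_reduce
    rw [Real.smoothTransition.one_of_one_le (by nlinarith [sq_nonneg x]), one_mul]
    refine (FormalMultilinearSeries.ofScalars_sum_eq c (x ^ 2)).trans ?_
    refine Eq.trans (tsum_congr fun n => ?_) (Real.hasSum_cos x).tsum_eq
    rw [smul_eq_mul, ← pow_mul]
    ring
  · beta_reduce
    rw [Real.smoothTransition.zero_of_nonpos (by linarith), zero_mul]

/-- Smooth functions all of whose derivatives are bounded. -/
structure BoundedDerivs {F : Type*} [NormedAddCommGroup F] [NormedSpace ℝ F]
    (D : ℝ → F) : Prop where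
  contDiff : ContDiff ℝ ∞ D
  bounded : ∀ n, ∃ C, ∀ x, ‖iteratedDeriv n D x‖ ≤ C

lemma BoundedDerivs.deriv {F : Type*} [NormedAddCommGroup F] [NormedSpace ℝ F]
    {D : ℝ → F} (h : BoundedDerivs D) : BoundedDerivs (deriv D) :=
  ⟨(contDiff_infty_iff_deriv.1 h.contDiff).2, fun n => by
    simpa [← iteratedDeriv_succ'] using h.bounded (n + 1)⟩

lemma ContDiff.hasDerivAt_iteratedDeriv {F : Type*} [NormedAddCommGroup F] [NormedSpace ℝ F]
    {D : ℝ → F} (h : ContDiff ℝ ∞ D) (n : ℕ) (x : ℝ) :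
    HasDerivAt (iteratedDeriv n D) (iteratedDeriv (n + 1) D x) x := by
  rw [iteratedDeriv_succ]
  exact ((h.differentiable_iteratedDeriv n (by exact_mod_cast WithTop.coe_lt_top _)) x).hasDerivAt

lemma exists_boundedDerivs_cos_sqrt :
    ∃ D : ℝ → ℝ, BoundedDerivs D ∧ ∀ x, D (x ^ 2) = Real.cos x := by
  obtain ⟨D, hD, hcos, hzero⟩ := exists_contDiff_cos_sqrt
  have hd := hD.hasDerivAt_iteratedDeriv
  refine ⟨D, ⟨hD, ?_⟩, hcos⟩
  have ode0 : ∀ y > 0, 4 * y * iteratedDeriv 2 D y + 2 * iteratedDeriv 1 D y + D y = 0 := by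
    intro y hy
    have e1 : ∀ x, iteratedDeriv 1 D (x ^ 2) * (2 * x) = -Real.sin x := by
      intro x
      have h1 : HasDerivAt (fun x => D (x ^ 2)) (iteratedDeriv 1 D (x ^ 2) * (2 * x)) x := by
        have := (hd 0 (x ^ 2)).comp x (hasDerivAt_pow 2 x)
        simpa [iteratedDeriv_zero, Function.comp_def] using this
      rw [show (fun x => D (x ^ 2)) = Real.cos from funext hcos] at h1
      exact h1.unique (Real.hasDerivAt_cos x)
    have h2 : ∀ x, HasDerivAt (fun x => iteratedDeriv 1 D (x ^ 2) * (2 * x))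
        (iteratedDeriv 2 D (x ^ 2) * (2 * x) * (2 * x) + iteratedDeriv 1 D (x ^ 2) * 2) x := by
      intro x
      have a := (hd 1 (x ^ 2)).comp x (hasDerivAt_pow 2 x)
      have b : HasDerivAt (fun x : ℝ => 2 * x) 2 x := by
        simpa using (hasDerivAt_id x).const_mul (2 : ℝ)
      refine (a.mul b).congr_deriv ?_
      simp
    have h3 := (h2 (√y)).unique (by
      rw [show (fun x => iteratedDeriv 1 D (x ^ 2) * (2 * x)) = fun x => -Real.sin x from funext e1]
      exact (Real.hasDerivAt_sin (√y)).neg)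
    rw [← hcos, Real.sq_sqrt hy.le] at h3
    have := Real.mul_self_sqrt hy.le
    linear_combination h3 - 4 * iteratedDeriv 2 D y * this
  have ode : ∀ k : ℕ, ∀ y > 0, 4 * y * iteratedDeriv (k + 2) D y
      + (4 * k + 2) * iteratedDeriv (k + 1) D y + iteratedDeriv k D y = 0 := by
    intro k
    induction k with
    | zero => intro y hy; simpa using ode0 y hy
    | succ k ih =>
      intro y hy
      have h1 : HasDerivAt (fun y => 4 * y * iteratedDeriv (k + 2) D y
          + (4 * k + 2) * iteratedDeriv (k + 1) D y + iteratedDeriv k D y)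
          (4 * iteratedDeriv (k + 2) D y + 4 * y * iteratedDeriv (k + 3) D y
          + (4 * k + 2) * iteratedDeriv (k + 2) D y + iteratedDeriv (k + 1) D y) y := by
        have a : HasDerivAt (fun y : ℝ => 4 * y) 4 y := by
          simpa using (hasDerivAt_id y).const_mul (4 : ℝ)
        exact ((a.mul (hd (k + 2) y)).add ((hd (k + 1) y).const_mul _)).add (hd k y)
      have h2 := h1.unique ((hasDerivAt_const y (0 : ℝ)).congr_of_eventuallyEq
        (by filter_upwards [lt_mem_nhds hy] with z hz using ih z hz))
      push_cast
      linear_combination h2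
  have key : ∀ n, ∃ C, ∀ x ≥ 1, |iteratedDeriv n D x| ≤ C := by
    have step : ∀ n, (∃ C, ∀ x ≥ 1, |iteratedDeriv n D x| ≤ C) ∧
        (∃ C, ∀ x ≥ 1, |iteratedDeriv (n + 1) D x| ≤ C) := by
      intro n
      induction n with
      | zero =>
        have e0 : ∀ x ≥ 1, |D x| ≤ 1 := by
          intro x hx
          rw [← Real.sq_sqrt (show 0 ≤ x by linarith), hcos]
          exact Real.abs_cos_le_one _
        refine ⟨⟨1, by simpa using e0⟩, 1, fun x hx => ?_⟩
        have h1 : HasDerivAt (fun x => Real.cos (√x)) (-Real.sin (√x) * (1 / (2 * √x))) x :=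
          (Real.hasDerivAt_cos _).comp x (Real.hasDerivAt_sqrt (by linarith))
        have h2 := (hd 0 x).unique (h1.congr_of_eventuallyEq (by
          filter_upwards [lt_mem_nhds (show (0:ℝ) < x by linarith)] with z hz
          rw [iteratedDeriv_zero, ← hcos, Real.sq_sqrt hz.le]))
        have h3 : 1 ≤ √x := Real.one_le_sqrt.2 hx
        rw [h2, abs_mul, abs_neg]
        refine mul_le_one₀ (Real.abs_sin_le_one _) (abs_nonneg _) ?_
        rw [abs_of_nonneg (by positivity), div_le_one (by positivity)]
        linarith
      | succ n ih =>
        refine ⟨ih.2, ?_⟩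
        obtain ⟨⟨C₀, h₀⟩, C₁, h₁⟩ := ih
        refine ⟨(4 * n + 2) * C₁ + C₀, fun x hx => ?_⟩
        have h := ode n x (by linarith)
        have h' : 4 * x * iteratedDeriv (n + 2) D x =
          -((4 * n + 2) * iteratedDeriv (n + 1) D x + iteratedDeriv n D x) := by linarith
        have h'' := congrArg abs h'
        rw [abs_mul, abs_neg, abs_of_nonneg (show 0 ≤ 4 * x by linarith)] at h''
        have t := abs_add_le ((4 * n + 2) * iteratedDeriv (n + 1) D x) (iteratedDeriv n D x)
        rw [abs_mul, abs_of_nonneg (show (0:ℝ) ≤ 4 * n + 2 by positivity)] at t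
        have t2 := mul_le_mul_of_nonneg_left (h₁ x hx) (show (0:ℝ) ≤ 4 * n + 2 by positivity)
        have t3 := h₀ x hx
        have t4 := abs_nonneg (iteratedDeriv (n + 2) D x)
        show |iteratedDeriv (n + 2) D x| ≤ _
        nlinarith
    exact fun n => (step n).1
  intro n
  obtain ⟨C, hC⟩ := key n
  obtain ⟨M, hM⟩ := (isCompact_Icc (a := (-3 : ℝ)) (b := 1)).exists_bound_of_continuousOn
    (hD.continuous_iteratedDeriv n (by exact_mod_cast le_top)).continuousOn
  have hz : ∀ x < -2, iteratedDeriv n D x = 0 := by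
    intro x hx
    have : D =ᶠ[𝓝 x] fun _ => 0 := by
      filter_upwards [gt_mem_nhds hx] with z hz using hzero z hz.le
    rw [this.iteratedDeriv_eq]
    simp
  refine ⟨max C M, fun x => ?_⟩
  rcases le_total 1 x with h | h
  · exact (hC x h).trans (le_max_left _ _)
  · rcases lt_or_ge x (-2) with h2 | h2
    · rw [hz x h2, norm_zero]
      exact le_max_of_le_left ((abs_nonneg _).trans (hC 1 le_rfl))
    · exact (hM x ⟨by linarith, h⟩).trans (le_max_right _ _)

universe u in
/-- A smooth function integrated over one variable in `[0, 1]` stays smooth. -/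
lemma ContDiff.parametric_integral_zero_one {E G : Type u} [NormedAddCommGroup E] [NormedSpace ℝ E]
    [FiniteDimensional ℝ E] [NormedAddCommGroup G] [NormedSpace ℝ G] [CompleteSpace G]
    {F : E × ℝ → G} (hF : ContDiff ℝ ∞ F) :
    ContDiff ℝ ∞ (fun x => ∫ s in (0 : ℝ)..1, F (x, s)) := by
  have key : ∀ n : ℕ, ∀ (G : Type u) [NormedAddCommGroup G] [NormedSpace ℝ G] [CompleteSpace G]
      (F : E × ℝ → G), ContDiff ℝ ∞ F → ContDiff ℝ n (fun x => ∫ s in (0 : ℝ)..1, F (x, s)) := by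
    intro n
    induction n with
    | zero =>
      intro G _ _ _ F hF
      exact contDiff_zero.2 (intervalIntegral.continuous_parametric_intervalIntegral_of_continuous'
        (f := fun x s => F (x, s)) hF.continuous 0 1)
    | succ n ih =>
      intro G _ _ _ F hF
      let F' : E × ℝ → E →L[ℝ] G := fun p => (fderiv ℝ F p).comp (ContinuousLinearMap.inl ℝ E ℝ)
      have hF' : ContDiff ℝ ∞ F' :=
        (hF.fderiv_right (m := ∞) (by simp)).clm_comp contDiff_const
      have hd : ∀ x, HasFDerivAt (fun x => ∫ s in (0 : ℝ)..1, F (x, s))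
          (∫ s in (0 : ℝ)..1, F' (x, s)) x := by
        intro x
        obtain ⟨M, hM⟩ := ((isCompact_closedBall x 1).prod
          (isCompact_Icc (a := (0 : ℝ)) (b := 1))).exists_bound_of_continuousOn
          hF'.continuous.continuousOn
        have hc := hF.continuous
        have hc' := hF'.continuous
        refine intervalIntegral.hasFDerivAt_integral_of_dominated_of_fderiv_le
          (F := fun x s => F (x, s)) (F' := fun x s => F' (x, s)) (bound := fun _ => M)
          (Metric.closedBall_mem_nhds x one_pos)
          (Eventually.of_forall fun y => Continuous.aestronglyMeasurable (by fun_prop))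
          (Continuous.intervalIntegrable (by fun_prop) _ _)
          (Continuous.aestronglyMeasurable (by fun_prop))
          (Eventually.of_forall fun s hs y hy => hM (y, s) ⟨hy, ?_⟩)
          (by simp)
          (Eventually.of_forall fun s _ y _ => ?_)
        · rw [uIoc_of_le zero_le_one] at hs
          exact ⟨hs.1.le, hs.2⟩
        · exact ((hF.differentiable (by simp)) (y, s)).hasFDerivAt.comp y
            (hasFDerivAt_prodMk_left y s)
      push_cast
      rw [contDiff_succ_iff_fderiv]
      refine ⟨fun x => (hd x).differentiableAt, by simp, ?_⟩
      rw [show fderiv ℝ (fun x => ∫ s in (0 : ℝ)..1, F (x, s)) = fun x => ∫ s in (0 : ℝ)..1, F' (x, s)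
        from funext fun x => (hd x).fderiv]
      exact ih _ F' hF'
  exact contDiff_infty.2 fun n => key n G F hF

open SchwartzMap in
/-- Superposition of the kernels `D₁ (ζ₀ u) D₂ (ζ₁² v)` with Schwartz weight `φ`. -/
noncomputable def kernelIntegral (φ : 𝓢(EuclideanSpace ℝ (Fin 2), ℂ)) (D₁ D₂ : ℝ → ℂ)
    (p : ℝ × ℝ) : ℂ :=
  ∫ ζ, φ ζ * (D₁ (ζ 0 * p.1) * D₂ (ζ 1 ^ 2 * p.2))

section
open SchwartzMap

lemma BoundedDerivs.exists_norm_le {D : ℝ → ℂ} (h : BoundedDerivs D) : ∃ C, ∀ x, ‖D x‖ ≤ C := by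
  simpa using h.bounded 0

lemma kernelIntegral_hasFDerivAt {φ φ₀ φ₁ : 𝓢(EuclideanSpace ℝ (Fin 2), ℂ)}
    (e₀ : ∀ ζ, φ₀ ζ = (ζ 0 : ℝ) * φ ζ) (e₁ : ∀ ζ, φ₁ ζ = ((ζ 1) ^ 2 : ℝ) * φ ζ) {D₁ D₂ : ℝ → ℂ}
    (h₁ : BoundedDerivs D₁) (h₂ : BoundedDerivs D₂) (p : ℝ × ℝ) :
    HasFDerivAt (kernelIntegral φ D₁ D₂)
      ((ContinuousLinearMap.fst ℝ ℝ ℝ).smulRight (kernelIntegral φ₀ (deriv D₁) D₂ p) +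
        (ContinuousLinearMap.snd ℝ ℝ ℝ).smulRight (kernelIntegral φ₁ D₁ (deriv D₂) p)) p := by
  obtain ⟨C₁, hC₁⟩ := h₁.exists_norm_le
  obtain ⟨C₂, hC₂⟩ := h₂.exists_norm_le
  obtain ⟨C₁', hC₁'⟩ := h₁.deriv.exists_norm_le
  obtain ⟨C₂', hC₂'⟩ := h₂.deriv.exists_norm_le
  have c₁ := h₁.contDiff.continuous
  have c₂ := h₂.contDiff.continuous
  have c₁' := h₁.deriv.contDiff.continuous
  have c₂' := h₂.deriv.contDiff.continuous
  have bd : ∀ {A B : ℝ → ℂ} {a b : ℝ}, (∀ x, ‖A x‖ ≤ a) → (∀ x, ‖B x‖ ≤ b) → ∀ x y,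
      ‖A x * B y‖ ≤ a * b := fun hA hB x y => by
    rw [norm_mul]
    exact mul_le_mul (hA x) (hB y) (norm_nonneg _) ((norm_nonneg _).trans (hA x))
  have int : ∀ (ψ : 𝓢(EuclideanSpace ℝ (Fin 2), ℂ)) {A B : ℝ → ℂ} {a b : ℝ}, Continuous A →
      Continuous B → (∀ x, ‖A x‖ ≤ a) → (∀ x, ‖B x‖ ≤ b) → ∀ q : ℝ × ℝ,
      Integrable (fun ζ => ψ ζ * (A (ζ 0 * q.1) * B (ζ 1 ^ 2 * q.2))) := by
    intro ψ A B a b cA cB hA hB q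
    exact ψ.integrable.mul_bdd (c := a * b) (Continuous.aestronglyMeasurable (by fun_prop))
      (Eventually.of_forall fun ζ => bd hA hB _ _)
  let F' : ℝ × ℝ → EuclideanSpace ℝ (Fin 2) → (ℝ × ℝ →L[ℝ] ℂ) := fun q ζ =>
    (ContinuousLinearMap.fst ℝ ℝ ℝ).smulRight
      (φ₀ ζ * (deriv D₁ (ζ 0 * q.1) * D₂ (ζ 1 ^ 2 * q.2))) +
    (ContinuousLinearMap.snd ℝ ℝ ℝ).smulRight
      (φ₁ ζ * (D₁ (ζ 0 * q.1) * deriv D₂ (ζ 1 ^ 2 * q.2)))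
  have L : ∀ (ℓ : ℝ × ℝ →L[ℝ] ℝ) (z : ℂ), ℓ.smulRight z = ContinuousLinearMap.smulRightL ℝ _ _ ℓ z :=
    fun _ _ => rfl
  have i₀ := int φ₀ c₁' c₂ hC₁' hC₂ p
  have i₁ := int φ₁ c₁ c₂' hC₁ hC₂' p
  have j₀ := (ContinuousLinearMap.smulRightL ℝ (ℝ × ℝ) ℂ
    (ContinuousLinearMap.fst ℝ ℝ ℝ)).integrable_comp i₀
  have j₁ := (ContinuousLinearMap.smulRightL ℝ (ℝ × ℝ) ℂ
    (ContinuousLinearMap.snd ℝ ℝ ℝ)).integrable_comp i₁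
  have hint : (∫ ζ, F' p ζ) = (ContinuousLinearMap.fst ℝ ℝ ℝ).smulRight
      (kernelIntegral φ₀ (deriv D₁) D₂ p) +
        (ContinuousLinearMap.snd ℝ ℝ ℝ).smulRight (kernelIntegral φ₁ D₁ (deriv D₂) p) := by
    simp only [F', kernelIntegral, L]
    rw [integral_add j₀ j₁, ContinuousLinearMap.integral_comp_comm _ i₀,
      ContinuousLinearMap.integral_comp_comm _ i₁]
  rw [← hint]
  have hmeas : AEStronglyMeasurable (F' p) := by
    simp only [F', L]
    exact j₀.aestronglyMeasurable.add j₁.aestronglyMeasurable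
  have hbound : ∀ ζ q, ‖F' q ζ‖ ≤ ‖φ₀ ζ‖ * (C₁' * C₂) + ‖φ₁ ζ‖ * (C₁ * C₂') := by
    intro ζ q
    refine (norm_add_le _ _).trans (add_le_add ?_ ?_)
    · rw [ContinuousLinearMap.norm_smulRight_apply, norm_mul]
      refine (mul_le_of_le_one_left (by positivity) (ContinuousLinearMap.norm_fst_le ℝ ℝ ℝ)).trans ?_
      exact mul_le_mul_of_nonneg_left (bd hC₁' hC₂ _ _) (norm_nonneg _)
    · rw [ContinuousLinearMap.norm_smulRight_apply, norm_mul]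
      refine (mul_le_of_le_one_left (by positivity) (ContinuousLinearMap.norm_snd_le ℝ ℝ ℝ)).trans ?_
      exact mul_le_mul_of_nonneg_left (bd hC₁ hC₂' _ _) (norm_nonneg _)
  have hdiff : ∀ ζ q, HasFDerivAt (fun q : ℝ × ℝ => φ ζ * (D₁ (ζ 0 * q.1) * D₂ (ζ 1 ^ 2 * q.2)))
      (F' q ζ) q := by
    intro ζ q
    have d₁ : HasFDerivAt (fun q : ℝ × ℝ => D₁ (ζ 0 * q.1))
        ((ζ 0 • ContinuousLinearMap.fst ℝ ℝ ℝ).smulRight (deriv D₁ (ζ 0 * q.1))) q := by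
      have l : HasFDerivAt (fun q : ℝ × ℝ => ζ 0 * q.1) (ζ 0 • ContinuousLinearMap.fst ℝ ℝ ℝ) q :=
        (ContinuousLinearMap.fst ℝ ℝ ℝ).hasFDerivAt.const_mul (ζ 0)
      refine (HasFDerivAt.comp q ((h₁.contDiff.differentiable (by simp))
        (ζ 0 * q.1)).hasDerivAt.hasFDerivAt l).congr_fderiv ?_
      ext <;> simp
    have d₂ : HasFDerivAt (fun q : ℝ × ℝ => D₂ (ζ 1 ^ 2 * q.2))
        ((ζ 1 ^ 2 • ContinuousLinearMap.snd ℝ ℝ ℝ).smulRight (deriv D₂ (ζ 1 ^ 2 * q.2))) q := by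
      have l : HasFDerivAt (fun q : ℝ × ℝ => ζ 1 ^ 2 * q.2) (ζ 1 ^ 2 • ContinuousLinearMap.snd ℝ ℝ ℝ) q :=
        (ContinuousLinearMap.snd ℝ ℝ ℝ).hasFDerivAt.const_mul (ζ 1 ^ 2)
      refine (HasFDerivAt.comp q ((h₂.contDiff.differentiable (by simp))
        (ζ 1 ^ 2 * q.2)).hasDerivAt.hasFDerivAt l).congr_fderiv ?_
      ext <;> simp
    have d := (d₁.mul d₂).const_mul (φ ζ)
    refine HasFDerivAt.congr_fderiv d ?_
    ext
    · simp [F', e₀]; ring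
    · simp [F', e₁]; ring
  have hmeas' : ∀ q : ℝ × ℝ, AEStronglyMeasurable
      (fun ζ => φ ζ * (D₁ (ζ 0 * q.1) * D₂ (ζ 1 ^ 2 * q.2))) volume :=
    fun q => (int φ c₁ c₂ hC₁ hC₂ q).aestronglyMeasurable
  have hbint : Integrable (fun ζ => ‖φ₀ ζ‖ * (C₁' * C₂) + ‖φ₁ ζ‖ * (C₁ * C₂')) :=
    (φ₀.integrable.norm.mul_const _).add (φ₁.integrable.norm.mul_const _)
  have := hasFDerivAt_integral_of_dominated_of_fderiv_le (s := univ) (𝕜 := ℝ) (x₀ := p) (μ := volume)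
    (F := fun q ζ => φ ζ * (D₁ (ζ 0 * q.1) * D₂ (ζ 1 ^ 2 * q.2))) (F' := F')
    (bound := fun ζ => ‖φ₀ ζ‖ * (C₁' * C₂) + ‖φ₁ ζ‖ * (C₁ * C₂'))
    univ_mem (Eventually.of_forall hmeas') (int φ c₁ c₂ hC₁ hC₂ p) hmeas
    (Eventually.of_forall fun ζ q _ => hbound ζ q) hbint
    (Eventually.of_forall fun ζ q _ => hdiff ζ q)
  exact this

lemma kernelIntegral_contDiff (φ : 𝓢(EuclideanSpace ℝ (Fin 2), ℂ)) {D₁ D₂ : ℝ → ℂ}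
    (h₁ : BoundedDerivs D₁) (h₂ : BoundedDerivs D₂) :
    ContDiff ℝ ∞ (kernelIntegral φ D₁ D₂) := by
  have t : ∀ i, Function.HasTemperateGrowth (fun ζ : EuclideanSpace ℝ (Fin 2) => ζ i) := fun i =>
    (EuclideanSpace.proj i : EuclideanSpace ℝ (Fin 2) →L[ℝ] ℝ).hasTemperateGrowth
  have m : ∀ (φ : 𝓢(EuclideanSpace ℝ (Fin 2), ℂ)) {g : EuclideanSpace ℝ (Fin 2) → ℝ},
      Function.HasTemperateGrowth g → ∃ ψ : 𝓢(EuclideanSpace ℝ (Fin 2), ℂ),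
        ∀ ζ, ψ ζ = (g ζ : ℝ) * φ ζ := fun φ g hg =>
    ⟨smulLeftCLM ℂ g φ, fun ζ => by rw [smulLeftCLM_apply_apply hg]; simp⟩
  refine contDiff_infty.2 fun n => ?_
  induction n generalizing φ D₁ D₂ with
  | zero =>
    obtain ⟨φ₀, e₀⟩ := m φ (t 0)
    obtain ⟨φ₁, e₁⟩ := m φ ((t 1).pow 2)
    exact contDiff_zero.2 (continuous_iff_continuousAt.2 fun p =>
      (kernelIntegral_hasFDerivAt e₀ e₁ h₁ h₂ p).continuousAt)
  | succ n ih =>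
    obtain ⟨φ₀, e₀⟩ := m φ (t 0)
    obtain ⟨φ₁, e₁⟩ := m φ ((t 1).pow 2)
    push_cast
    rw [contDiff_succ_iff_fderiv]
    refine ⟨fun p => (kernelIntegral_hasFDerivAt e₀ e₁ h₁ h₂ p).differentiableAt, by simp, ?_⟩
    rw [funext fun p => (kernelIntegral_hasFDerivAt e₀ e₁ h₁ h₂ p).fderiv]
    exact (contDiff_const.smulRight (ih _ h₁.deriv h₂)).add
      (contDiff_const.smulRight (ih _ h₁ h₂.deriv))

end

lemma BoundedDerivs.comp_const_mul {F : Type*} [NormedAddCommGroup F] [NormedSpace ℝ F]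
    {D : ℝ → F} (h : BoundedDerivs D) (c : ℝ) : BoundedDerivs (fun x => D (c * x)) where
  contDiff := h.contDiff.comp (contDiff_const.mul contDiff_id)
  bounded n := by
    obtain ⟨C, hC⟩ := h.bounded n
    refine ⟨‖c ^ n‖ * C, fun x => ?_⟩
    rw [iteratedDeriv_comp_const_smul (h.contDiff.of_le (mod_cast le_top)) c, norm_smul]
    exact mul_le_mul_of_nonneg_left (hC _) (norm_nonneg _)

lemma BoundedDerivs.ofReal {D : ℝ → ℝ} (h : BoundedDerivs D) :
    BoundedDerivs (fun x => (D x : ℂ)) where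
  contDiff := Complex.ofRealCLM.contDiff.comp h.contDiff
  bounded n := by
    obtain ⟨C, hC⟩ := h.bounded n
    refine ⟨C, fun x => ?_⟩
    rw [← norm_iteratedFDeriv_eq_norm_iteratedDeriv]
    have := Complex.ofRealLI.norm_iteratedFDeriv_comp_left (f := D) (x := x) (n := ∞)
      h.contDiff.contDiffAt (i := n) (mod_cast le_top)
    rw [norm_iteratedFDeriv_eq_norm_iteratedDeriv (f := D)] at this
    exact this.trans_le (hC x)

lemma boundedDerivs_cexp : BoundedDerivs (fun x : ℝ => Complex.exp (x * Complex.I)) where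
  contDiff := (Complex.ofRealCLM.contDiff.mul contDiff_const).cexp
  bounded n := by
    refine ⟨1, fun x => ?_⟩
    have : iteratedDeriv n (fun x : ℝ => Complex.exp (x * Complex.I)) =
        fun x : ℝ => Complex.I ^ n * Complex.exp (x * Complex.I) := by
      induction n with
      | zero => simp
      | succ n ih =>
        rw [iteratedDeriv_succ, ih]
        funext x
        have h : HasDerivAt (fun x : ℝ => Complex.exp (x * Complex.I))
            (Complex.exp (x * Complex.I) * (1 * Complex.I)) x :=
          ((Complex.ofRealCLM.hasDerivAt.mul_const Complex.I).cexp)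
        rw [(h.const_mul _).deriv]
        ring
    simp [this, Complex.norm_exp_ofReal_mul_I]

open SchwartzMap FourierTransform in
/-- **Whitney**: near the origin, a smooth function splits into an even and an odd part in its second
variable, both smooth in the square of that variable. -/
theorem exists_even_add_odd {g : ℝ × ℝ → ℝ} (hg : ContDiff ℝ ∞ g) :
    ∃ G H : ℝ × ℝ → ℝ, ContDiff ℝ ∞ G ∧ ContDiff ℝ ∞ H ∧
      ∀ᶠ p in 𝓝 (0 : ℝ × ℝ), g p = G (p.1, p.2 ^ 2) + p.2 * H (p.1, p.2 ^ 2) := by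
  obtain ⟨D, hD, hcos⟩ := exists_boundedDerivs_cos_sqrt
  have hsin : ∀ x, Real.sin x = -2 * x * deriv D (x ^ 2) := by
    intro x
    have h₁ : HasDerivAt (fun x => D (x ^ 2)) (deriv D (x ^ 2) * (2 * x)) x := by
      have := ((hD.contDiff.differentiable (by simp)) (x ^ 2)).hasDerivAt.comp x (hasDerivAt_pow 2 x)
      simpa [Function.comp_def] using this
    rw [funext hcos] at h₁
    have := h₁.unique (Real.hasDerivAt_cos x)
    linarith
  let χ : ContDiffBump (0 : EuclideanSpace ℝ (Fin 2)) := ⟨1, 2, one_pos, one_lt_two⟩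
  let f₀ : EuclideanSpace ℝ (Fin 2) → ℂ := fun x => ((χ x * g (x 0, x 1) : ℝ) : ℂ)
  have hf₀ : ContDiff ℝ ∞ f₀ := by
    have c : ∀ i, ContDiff ℝ ∞ (fun x : EuclideanSpace ℝ (Fin 2) => x i) := fun i =>
      (EuclideanSpace.proj i : EuclideanSpace ℝ (Fin 2) →L[ℝ] ℝ).contDiff
    exact Complex.ofRealCLM.contDiff.comp (χ.contDiff.mul (hg.comp ((c 0).prodMk (c 1))))
  have hs₀ : HasCompactSupport f₀ := by
    refine χ.hasCompactSupport.mono fun x hx => ?_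
    contrapose! hx
    simp only [Function.mem_support, not_not] at hx ⊢
    simp [f₀, hx]
  let f : 𝓢(EuclideanSpace ℝ (Fin 2), ℂ) := hs₀.toSchwartzMap hf₀
  have tg : Function.HasTemperateGrowth (fun ζ : EuclideanSpace ℝ (Fin 2) => ζ 1) :=
    (EuclideanSpace.proj 1 : EuclideanSpace ℝ (Fin 2) →L[ℝ] ℝ).hasTemperateGrowth
  let ψ : 𝓢(EuclideanSpace ℝ (Fin 2), ℂ) :=
    smulLeftCLM ℂ (fun ζ : EuclideanSpace ℝ (Fin 2) => ζ 1) (𝓕 f)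
  have hψ : ∀ ζ, ψ ζ = (ζ 1 : ℝ) * 𝓕 f ζ := fun ζ => by
    simp only [ψ]
    rw [smulLeftCLM_apply_apply tg]
    simp
  let D₁ : ℝ → ℂ := fun x => Complex.exp ((2 * Real.pi * x : ℝ) * Complex.I)
  let D₂ : ℝ → ℂ := fun y => (D ((4 * Real.pi ^ 2) * y) : ℂ)
  let D₃ : ℝ → ℂ := fun y => ((deriv D ((4 * Real.pi ^ 2) * y) : ℝ) : ℂ)
  have hD₁ : BoundedDerivs D₁ := boundedDerivs_cexp.comp_const_mul (2 * Real.pi)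
  have hD₂ : BoundedDerivs D₂ := hD.ofReal.comp_const_mul (4 * Real.pi ^ 2)
  have hD₃ : BoundedDerivs D₃ := hD.deriv.ofReal.comp_const_mul (4 * Real.pi ^ 2)
  let c : ℂ := -4 * Real.pi * Complex.I
  have key : ∀ u w : ℝ, f !₂[u, w] =
      kernelIntegral (𝓕 f) D₁ D₂ (u, w ^ 2) + w * (c * kernelIntegral ψ D₁ D₃ (u, w ^ 2)) := by
    intro u w
    obtain ⟨C₁, hC₁⟩ := hD₁.exists_norm_le
    obtain ⟨C₂, hC₂⟩ := hD₂.exists_norm_le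
    obtain ⟨C₃, hC₃⟩ := hD₃.exists_norm_le
    have int : ∀ (φ : 𝓢(EuclideanSpace ℝ (Fin 2), ℂ)) {B : ℝ → ℂ} {b : ℝ}, Continuous B →
        (∀ x, ‖B x‖ ≤ b) →
        Integrable (fun ζ => φ ζ * (D₁ (ζ 0 * u) * B (ζ 1 ^ 2 * w ^ 2))) := by
      intro φ B b cB hB
      have c₁ := hD₁.contDiff.continuous
      refine φ.integrable.mul_bdd (c := C₁ * b) (Continuous.aestronglyMeasurable (by fun_prop))
        (Eventually.of_forall fun ζ => ?_)
      rw [norm_mul]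
      exact mul_le_mul (hC₁ _) (hB _) (norm_nonneg _) ((norm_nonneg _).trans (hC₁ 0))
    have i₂ := int (𝓕 f) hD₂.contDiff.continuous hC₂
    have i₃ := int ψ hD₃.contDiff.continuous hC₃
    have h₁ : f !₂[u, w] = 𝓕⁻ (𝓕 f) !₂[u, w] := by rw [FourierPair.fourierInv_fourier_eq]
    rw [h₁, fourierInv_coe, Real.fourierInv_eq']
    simp only [kernelIntegral]
    rw [← integral_const_mul, ← integral_const_mul, ← integral_add i₂ ((i₃.const_mul _).const_mul _)]
    refine integral_congr_ae (Eventually.of_forall fun ζ => ?_)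
    beta_reduce
    have hin : inner ℝ ζ !₂[u, w] = ζ 0 * u + ζ 1 * w := by
      simp [PiLp.inner_apply, Fin.sum_univ_two, mul_comm]
    have hexp : Complex.exp (((2 * Real.pi * (ζ 0 * u + ζ 1 * w) : ℝ) : ℂ) * Complex.I) =
        D₁ (ζ 0 * u) * (D₂ (ζ 1 ^ 2 * w ^ 2) + w * (c * (ζ 1 * D₃ (ζ 1 ^ 2 * w ^ 2)))) := by
      have e : ((2 * Real.pi * (ζ 0 * u + ζ 1 * w) : ℝ) : ℂ) * Complex.I =
        (2 * Real.pi * (ζ 0 * u) : ℝ) * Complex.I + (2 * Real.pi * (ζ 1 * w) : ℝ) * Complex.I := by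
        push_cast; ring
      have e₂ : 4 * Real.pi ^ 2 * (ζ 1 ^ 2 * w ^ 2) = (2 * Real.pi * (ζ 1 * w)) ^ 2 := by ring
      rw [e, Complex.exp_add, Complex.exp_mul_I, Complex.exp_mul_I, ← Complex.ofReal_cos,
        ← Complex.ofReal_sin, ← Complex.ofReal_cos, ← Complex.ofReal_sin]
      simp only [D₁, D₂, D₃, e₂, c]
      rw [Complex.exp_mul_I, ← Complex.ofReal_cos, ← Complex.ofReal_sin, hcos,
        hsin (2 * Real.pi * (ζ 1 * w))]
      push_cast
      ring
    rw [hin, smul_eq_mul, hexp, hψ]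
    ring
  refine ⟨fun p => (kernelIntegral (𝓕 f) D₁ D₂ p).re, fun p => (c * kernelIntegral ψ D₁ D₃ p).re,
    Complex.reCLM.contDiff.comp (kernelIntegral_contDiff _ hD₁ hD₂),
    Complex.reCLM.contDiff.comp (contDiff_const.mul (kernelIntegral_contDiff _ hD₁ hD₃)), ?_⟩
  have hc : Continuous fun p : ℝ × ℝ => (!₂[p.1, p.2] : EuclideanSpace ℝ (Fin 2)) := by fun_prop
  have h0 : (!₂[(0 : ℝ), 0] : EuclideanSpace ℝ (Fin 2)) = 0 := by ext i; fin_cases i <;> simp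
  have hχ : ∀ᶠ p : ℝ × ℝ in 𝓝 0, χ !₂[p.1, p.2] = 1 := by
    refine hc.continuousAt.eventually (p := fun x => χ x = 1) ?_
    change ∀ᶠ y in 𝓝 (!₂[(0 : ℝ), 0] : EuclideanSpace ℝ (Fin 2)), χ y = 1
    rw [h0]
    exact χ.eventuallyEq_one
  filter_upwards [hχ] with p hp
  have := congrArg Complex.re (key p.1 p.2)
  rw [Complex.add_re, Complex.re_ofReal_mul] at this
  rw [← this]
  change g p = (f₀ !₂[p.1, p.2]).re
  simp [f₀, hp]

section Germs

variable {E F E' F' : Type*} [NormedAddCommGroup E] [NormedSpace ℝ E] [NormedAddCommGroup F]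
  [NormedSpace ℝ F] [NormedAddCommGroup E'] [NormedSpace ℝ E'] [NormedAddCommGroup F']
  [NormedSpace ℝ F']

/-- A map that is smooth near `p` agrees near `p` with a globally smooth map. -/
lemma exists_contDiff_eventuallyEq [FiniteDimensional ℝ E] {f : E → F} {p : E}
    (hf : ∀ᶠ x in 𝓝 p, ContDiffAt ℝ ∞ f x) : ∃ f' : E → F, ContDiff ℝ ∞ f' ∧ f' =ᶠ[𝓝 p] f := by
  obtain ⟨r, hr, hball⟩ := Metric.eventually_nhds_iff_ball.1 hf
  let χ : ContDiffBump p := ⟨r / 4, r / 2, by positivity, by linarith⟩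
  refine ⟨fun x => χ x • f x, contDiff_iff_contDiffAt.2 fun x => ?_, ?_⟩
  · by_cases hx : x ∈ Metric.ball p r
    · exact χ.contDiff.contDiffAt.smul (hball x hx)
    · have hx' : x ∈ (Metric.closedBall p (r / 2))ᶜ := by
        simp only [Metric.mem_ball, not_lt, mem_compl_iff, Metric.mem_closedBall, not_le] at hx ⊢
        linarith
      have h0 : (fun x => χ x • f x) =ᶠ[𝓝 x] fun _ => 0 := by
        filter_upwards [Metric.isClosed_closedBall.isOpen_compl.mem_nhds hx'] with y hy
        rw [χ.zero_of_le_dist, zero_smul]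
        simp only [mem_compl_iff, Metric.mem_closedBall, not_le] at hy
        exact hy.le
      exact contDiffAt_const.congr_of_eventuallyEq h0
  · filter_upwards [χ.eventuallyEq_one] with x hx
    simp [hx]

/-- `σ` is a germ of diffeomorphism at `p`, in infinitesimal form. -/
structure IsDiffeoGerm (σ : E → F) (p : E) : Prop where
  smooth : ∀ᶠ x in 𝓝 p, ContDiffAt ℝ ∞ σ x
  exists_equiv : ∃ e : E ≃L[ℝ] F, HasFDerivAt σ (e : E →L[ℝ] F) p

lemma IsDiffeoGerm.continuousAt {σ : E → F} {p : E} (h : IsDiffeoGerm σ p) : ContinuousAt σ p :=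
  h.exists_equiv.choose_spec.continuousAt

lemma IsDiffeoGerm.comp {τ : F → F'} {σ : E → F} {p : E} (hτ : IsDiffeoGerm τ (σ p))
    (hσ : IsDiffeoGerm σ p) : IsDiffeoGerm (τ ∘ σ) p := by
  obtain ⟨e, he⟩ := hσ.exists_equiv
  obtain ⟨e', he'⟩ := hτ.exists_equiv
  refine ⟨?_, e.trans e', he'.comp p he⟩
  filter_upwards [hσ.smooth, hσ.continuousAt.eventually hτ.smooth] with x hx hx'
  exact hx'.comp x hx

lemma IsDiffeoGerm.of_injective [FiniteDimensional ℝ E] [FiniteDimensional ℝ F] {σ : E → F} {p : E}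
    (h : ContDiff ℝ ∞ σ) {L : E →L[ℝ] F} (hL : HasFDerivAt σ L p) (hi : ∀ v, L v = 0 → v = 0)
    (hd : Module.finrank ℝ E = Module.finrank ℝ F) : IsDiffeoGerm σ p := by
  refine ⟨Eventually.of_forall fun x => h.contDiffAt,
    (LinearEquiv.ofInjectiveOfFinrankEq (L : E →ₗ[ℝ] F)
      ((injective_iff_map_eq_zero _).2 hi) hd).toContinuousLinearEquiv, ?_⟩
  convert hL
  ext x
  exact LinearMap.congr_fun (LinearEquiv.coe_ofInjectiveOfFinrankEq (L : E →ₗ[ℝ] F) _ hd) x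

lemma IsDiffeoGerm.exists_isOpen [CompleteSpace E] {σ : E → F} {p : E} (h : IsDiffeoGerm σ p) :
    ∃ (U : Set E) (σi : F → E), IsOpen U ∧ p ∈ U ∧ (∀ x ∈ U, ContDiffAt ℝ ∞ σ x) ∧
      (∀ x ∈ U, σi (σ x) = x) ∧ (∀ x ∈ U, ContDiffAt ℝ ∞ σi (σ x)) ∧
      ∀ᶠ y in 𝓝 (σ p), σ (σi y) = y := by
  obtain ⟨e, he⟩ := h.exists_equiv
  have hp : ContDiffAt ℝ ∞ σ p := h.smooth.self_of_nhds
  let Φ := hp.toOpenPartialHomeomorph σ he (by simp)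
  have hΦ : (Φ : E → F) = σ := hp.toOpenPartialHomeomorph_coe he (by simp)
  have hps : p ∈ Φ.source := hp.mem_toOpenPartialHomeomorph_source he (by simp)
  have hinv : ∀ᶠ x in 𝓝 p, ∃ e : E ≃L[ℝ] F, HasFDerivAt σ (e : E →L[ℝ] F) x := by
    have hc : ContinuousAt (fderiv ℝ σ) p :=
      (hp.fderiv_right (m := 0) (by simp)).continuousAt
    have hn : range ((↑) : (E ≃L[ℝ] F) → E →L[ℝ] F) ∈ 𝓝 (fderiv ℝ σ p) := by
      rw [he.fderiv]
      exact ContinuousLinearEquiv.nhds e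
    filter_upwards [hc hn, h.smooth] with x hx hs
    obtain ⟨e', he'⟩ := hx
    exact ⟨e', he' ▸ (hs.differentiableAt (by simp)).hasFDerivAt⟩
  obtain ⟨U, hU, hUo, hpU⟩ := mem_nhds_iff.1
    ((Φ.open_source.eventually_mem hps).and (h.smooth.and hinv))
  refine ⟨U, Φ.symm, hUo, hpU, fun x hx => (hU hx).2.1, fun x hx => ?_, fun x hx => ?_, ?_⟩
  · rw [← hΦ]
    exact Φ.left_inv (hU hx).1
  · obtain ⟨hs, hc, e', he'⟩ := hU hx
    have hl : Φ.symm (σ x) = x := by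
      rw [← hΦ]
      exact Φ.left_inv hs
    have ht : σ x ∈ Φ.target := by
      rw [← hΦ]
      exact Φ.map_source hs
    refine Φ.contDiffAt_symm ht (f₀' := e') ?_ ?_
    · rw [hl, hΦ]; exact he'
    · rw [hl, hΦ]; exact hc
  · have ht : σ p ∈ Φ.target := by
      rw [← hΦ]
      exact Φ.map_source hps
    filter_upwards [Φ.open_target.eventually_mem ht] with y hy
    rw [← hΦ]
    exact Φ.right_inv hy

lemma IsDiffeoGerm.exists_inverse [CompleteSpace E] [FiniteDimensional ℝ F] {σ : E → F} {p : E}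
    (h : IsDiffeoGerm σ p) : ∃ σi : F → E, ContDiff ℝ ∞ σi ∧ σi (σ p) = p ∧
      (∀ᶠ x in 𝓝 p, σi (σ x) = x) ∧ ∀ᶠ y in 𝓝 (σ p), σ (σi y) = y := by
  obtain ⟨U, σi, hUo, hpU, hs, hl, hi, hr⟩ := h.exists_isOpen
  have hic : ContinuousAt σi (σ p) := (hi p hpU).continuousAt
  have hsm : ∀ᶠ y in 𝓝 (σ p), ContDiffAt ℝ ∞ σi y := by
    have : ∀ᶠ y in 𝓝 (σ p), σi y ∈ U :=
      hic.eventually (p := (· ∈ U)) (by rw [hl p hpU]; exact hUo.mem_nhds hpU)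
    filter_upwards [this, hr] with y hy hy'
    simpa [hy'] using hi _ hy
  obtain ⟨τ, hτ, hττ⟩ := exists_contDiff_eventuallyEq hsm
  refine ⟨τ, hτ, by rw [hττ.self_of_nhds, hl p hpU], ?_, ?_⟩
  · filter_upwards [h.continuousAt.eventually hττ, hUo.mem_nhds hpU] with x hx hxU
    rw [hx, hl x hxU]
  · filter_upwards [hττ, hr] with y hy hy'
    rw [hy, hy']

/-- Equivalence of map germs up to diffeomorphism germs, allowing different model spaces. -/
def GermEquiv (f : E → F) (p : E) (g : E' → F') (q : E') : Prop :=
  ∃ (σ : E → E') (τ : F → F'), IsDiffeoGerm σ p ∧ σ p = q ∧ IsDiffeoGerm τ (f p) ∧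
    ∀ᶠ x in 𝓝 p, τ (f x) = g (σ x)

lemma GermEquiv.trans {E'' F'' : Type*} [NormedAddCommGroup E''] [NormedSpace ℝ E'']
    [NormedAddCommGroup F''] [NormedSpace ℝ F''] {f : E → F} {p : E} {g : E' → F'} {q : E'}
    {k : E'' → F''} {r : E''} (h : GermEquiv f p g q) (h' : GermEquiv g q k r) :
    GermEquiv f p k r := by
  obtain ⟨σ, τ, hσ, rfl, hτ, e⟩ := h
  obtain ⟨σ', τ', hσ', rfl, hτ', e'⟩ := h'
  refine ⟨σ' ∘ σ, τ' ∘ τ, hσ'.comp hσ, rfl, IsDiffeoGerm.comp ?_ hτ, ?_⟩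
  · rwa [e.self_of_nhds]
  · filter_upwards [e, hσ.continuousAt.eventually e'] with x hx hx'
    simp only [Function.comp_apply, hx, hx']

lemma GermEquiv.locallyDiffeomorphic [CompleteSpace E] [CompleteSpace F] {f g : E → F} {p q : E}
    (h : GermEquiv f p g q) (hf : ContinuousAt f p) : LocallyDiffeomorphic f p g q := by
  obtain ⟨σ, τ, hσ, hq, hτ, e⟩ := h
  obtain ⟨U₀, σi, hU₀, hpU₀, s, l, i, -⟩ := hσ.exists_isOpen
  obtain ⟨W, τi, hW, hpW, s', l', i', -⟩ := hτ.exists_isOpen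
  obtain ⟨U, hU, hUo, hpU⟩ := mem_nhds_iff.1
    (((hU₀.eventually_mem hpU₀).and (hf.eventually (hW.eventually_mem hpW))).and e)
  refine ⟨σ, σi, τ, τi, U, W, hUo, hpU, hW, hpW,
    fun x hx => (s x (hU hx).1.1).contDiffWithinAt, fun y hy => (s' y hy).contDiffWithinAt,
    fun x hx => l x (hU hx).1.1, l', ?_, ?_, hq, ?_, fun x hx => (hU hx).2⟩
  · rintro _ ⟨x, hx, rfl⟩
    exact (i x (hU hx).1.1).contDiffWithinAt
  · rintro _ ⟨y, hy, rfl⟩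
    exact (i' y hy).contDiffWithinAt
  · rintro _ ⟨x, hx, rfl⟩
    exact (hU hx).1.2

end Germs

/-- A smooth map with a smooth left inverse between spaces of equal dimension is a diffeomorphism
germ. -/
lemma IsDiffeoGerm.of_leftInverse {E F : Type*} [NormedAddCommGroup E] [NormedSpace ℝ E]
    [NormedAddCommGroup F] [NormedSpace ℝ F] [FiniteDimensional ℝ E] [FiniteDimensional ℝ F]
    {σ : E → F} {σi : F → E} (h : ContDiff ℝ ∞ σ) (h' : ContDiff ℝ ∞ σi)
    (hl : Function.LeftInverse σi σ) (hd : Module.finrank ℝ E = Module.finrank ℝ F) (p : E) :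
    IsDiffeoGerm σ p := by
  have a := ((h.differentiable (by simp)) p).hasFDerivAt
  have b := ((h'.differentiable (by simp)) (σ p)).hasFDerivAt
  refine .of_injective h a (fun v hv => ?_) hd
  have c := b.comp p a
  rw [hl.comp_eq_id] at c
  have := congrArg (· v) (c.unique (hasFDerivAt_id p))
  simpa [hv] using this.symm

/-- The standard cuspidal cross cap. -/
def cuspidalCrossCap (p : ℝ × ℝ) : ℝ × ℝ × ℝ := (p.1, p.2 ^ 2, p.1 * p.2 ^ 3)

lemma cuspidalCrossCap_germEquiv_foldedUmbrella : GermEquiv cuspidalCrossCap (0, 0)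
    (fun p : ℝ × ℝ => ![p.1, p.2 ^ 2 + p.1 * p.2, p.2 ^ 4 + (2 / 3) * p.1 * p.2 ^ 3]) (0, 0) := by
  refine ⟨fun p => (-(3 / 4) * p.1, p.2 + 3 / 8 * p.1),
    fun q => ![-(3 / 4) * q.1, q.2.1 - (3 / 8 * q.1) ^ 2,
      q.2.2 + q.2.1 ^ 2 + 2 * (3 / 8 * q.1) ^ 2 * q.2.1 - (3 / 8 * q.1) ^ 4 / 3], ?_, by simp, ?_,
      Eventually.of_forall fun p => ?_⟩
  · exact .of_leftInverse (σi := fun p => (-(4 / 3) * p.1, p.2 + 1 / 2 * p.1)) (by fun_prop)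
      (by fun_prop) (fun p => by ext <;> simp <;> ring) rfl _
  · refine .of_leftInverse (σi := fun q => (-(4 / 3) * q 0, q 1 + (1 / 2 * q 0) ^ 2,
      q 2 - ((q 1 + (1 / 2 * q 0) ^ 2) ^ 2 + 2 * (1 / 2 * q 0) ^ 2 * (q 1 + (1 / 2 * q 0) ^ 2)
        - (1 / 2 * q 0) ^ 4 / 3))) ?_ (by fun_prop) (fun p => ?_) (by simp) _
    · refine contDiff_pi.2 fun i => ?_
      fin_cases i <;> simp <;> fun_prop
    · ext <;> simp <;> ring
  · ext i
    fin_cases i <;> simp [cuspidalCrossCap] <;> ring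

lemma hasDerivAt_prodMk_left_of_contDiff {F : Type*} [NormedAddCommGroup F] [NormedSpace ℝ F]
    {h : ℝ × ℝ → F} (hh : ContDiff ℝ ∞ h) (u w : ℝ) :
    HasDerivAt (fun u => h (u, w)) (fderiv ℝ h (u, w) (1, 0)) u :=
  ((hh.differentiable (by simp)) (u, w)).hasFDerivAt.comp_hasDerivAt u
    ((hasDerivAt_id u).prodMk (hasDerivAt_const u w))

lemma hasDerivAt_prodMk_right_of_contDiff {F : Type*} [NormedAddCommGroup F] [NormedSpace ℝ F]
    {h : ℝ × ℝ → F} (hh : ContDiff ℝ ∞ h) (u w : ℝ) :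
    HasDerivAt (fun w => h (u, w)) (fderiv ℝ h (u, w) (0, 1)) w :=
  ((hh.differentiable (by simp)) (u, w)).hasFDerivAt.comp_hasDerivAt w
    ((hasDerivAt_const w u).prodMk (hasDerivAt_id w))

/-- Change of coordinates to the cuspidal cross cap, once the odd part of the third component is
known to be `w ^ 3 * h (u, w ^ 2)` with `h` vanishing to first order along the first axis. -/
lemma germEquiv_cuspidalCrossCap_of_eq {B G h : ℝ × ℝ → ℝ} (hG : ContDiff ℝ ∞ G)
    (hh : ContDiff ℝ ∞ h)
    (hB : ∀ᶠ p in 𝓝 ((0, 0) : ℝ × ℝ), B p = G (p.1, p.2 ^ 2) + p.2 ^ 3 * h (p.1, p.2 ^ 2))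
    (h0 : h (0, 0) = 0) {κ : ℝ} (hκ : κ ≠ 0) (h1 : HasDerivAt (fun u => h (u, 0)) κ 0) :
    GermEquiv (fun p : ℝ × ℝ => (p.1, p.2 ^ 2, B p)) (0, 0) cuspidalCrossCap (0, 0) := by
  have hd := ((hh.differentiable (by simp)) ((0, 0) : ℝ × ℝ)).hasFDerivAt
  have hGd := ((hG.differentiable (by simp)) ((0, 0) : ℝ × ℝ)).hasFDerivAt
  have hκ' : fderiv ℝ h (0, 0) (1, 0) = κ := (hasDerivAt_prodMk_left_of_contDiff hh 0 0).unique h1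
  have hker : ∀ a : ℝ, fderiv ℝ h (0, 0) (a, 0) = 0 → a = 0 := by
    intro a ha
    have : ((a, 0) : ℝ × ℝ) = a • (1, 0) := by simp
    rw [this, map_smul, hκ', smul_eq_mul] at ha
    exact (mul_eq_zero.1 ha).resolve_right hκ
  have hB0 : B (0, 0) = G (0, 0) := by simpa using hB.self_of_nhds
  refine ⟨fun p => (h (p.1, p.2 ^ 2), p.2), fun q => (h (q.1, q.2.1), q.2.1, q.2.2 - G (q.1, q.2.1)),
    ?_, by simp [h0], ?_, ?_⟩
  · have sq : HasFDerivAt (fun p : ℝ × ℝ => p.2 ^ 2) (0 : ℝ × ℝ →L[ℝ] ℝ) (0, 0) := by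
      refine ((hasFDerivAt_snd (𝕜 := ℝ) (p := ((0, 0) : ℝ × ℝ))).pow 2).congr_fderiv ?_
      simp
    have l := (hasFDerivAt_fst (𝕜 := ℝ) (p := ((0, 0) : ℝ × ℝ))).prodMk sq
    have hd' : HasFDerivAt h (fderiv ℝ h (0, 0))
      ((fun p : ℝ × ℝ => (p.1, p.2 ^ 2)) (0, 0)) := by simpa using hd
    refine .of_injective (by fun_prop) ((hd'.comp (0, 0) l).prodMk hasFDerivAt_snd) ?_ rfl
    rintro ⟨a, b⟩ hab
    simp only [ContinuousLinearMap.prod_apply, ContinuousLinearMap.comp_apply, Prod.mk_eq_zero,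
      ContinuousLinearMap.coe_fst', ContinuousLinearMap.coe_snd',
      zero_apply] at hab
    simp [hker a hab.1, hab.2]
  · have l : HasFDerivAt (fun q : ℝ × ℝ × ℝ => (q.1, q.2.1)) ((ContinuousLinearMap.fst ℝ ℝ (ℝ × ℝ)).prod
        ((ContinuousLinearMap.fst ℝ ℝ ℝ).comp (ContinuousLinearMap.snd ℝ ℝ (ℝ × ℝ))))
        (0, 0, G (0, 0)) :=
      ContinuousLinearMap.hasFDerivAt ((ContinuousLinearMap.fst ℝ ℝ (ℝ × ℝ)).prod
        ((ContinuousLinearMap.fst ℝ ℝ ℝ).comp (ContinuousLinearMap.snd ℝ ℝ (ℝ × ℝ))))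
    have m : HasFDerivAt (fun q : ℝ × ℝ × ℝ => q.2.1)
        ((ContinuousLinearMap.fst ℝ ℝ ℝ).comp (ContinuousLinearMap.snd ℝ ℝ (ℝ × ℝ)))
        (0, 0, G (0, 0)) :=
      ContinuousLinearMap.hasFDerivAt
        ((ContinuousLinearMap.fst ℝ ℝ ℝ).comp (ContinuousLinearMap.snd ℝ ℝ (ℝ × ℝ)))
    have n : HasFDerivAt (fun q : ℝ × ℝ × ℝ => q.2.2)
        ((ContinuousLinearMap.snd ℝ ℝ ℝ).comp (ContinuousLinearMap.snd ℝ ℝ (ℝ × ℝ)))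
        (0, 0, G (0, 0)) :=
      ContinuousLinearMap.hasFDerivAt
        ((ContinuousLinearMap.snd ℝ ℝ ℝ).comp (ContinuousLinearMap.snd ℝ ℝ (ℝ × ℝ)))
    have e : ((0 : ℝ), (0 : ℝ) ^ 2, B (0, 0)) = (0, 0, G (0, 0)) := by simp [hB0]
    dsimp only
    rw [e]
    refine .of_injective (by fun_prop)
      ((hd.comp (0, 0, G (0, 0)) l).prodMk (m.prodMk (n.sub (hGd.comp (0, 0, G (0, 0)) l)))) ?_ rfl
    rintro ⟨a, b, c⟩ habc
    simp only [ContinuousLinearMap.prod_apply, ContinuousLinearMap.comp_apply, Prod.mk_eq_zero,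
      ContinuousLinearMap.coe_fst', ContinuousLinearMap.coe_snd',
      sub_apply] at habc
    obtain ⟨h1, rfl, h3⟩ := habc
    obtain rfl := hker a h1
    have : ((0, 0) : ℝ × ℝ) = 0 := rfl
    rw [this, map_zero, sub_zero] at h3
    simp [h3]
  · filter_upwards [hB] with p hp
    simp only [cuspidalCrossCap, hp, Prod.mk.injEq, true_and]
    ring

/-- A function `B` with `∂B/∂w = -2 w C` has odd part `w ^ 3 * h (u, w ^ 2)`, where `h` is governed on
the axis by `∂C/∂w`. -/
lemma exists_even_add_cube_mul {B C : ℝ × ℝ → ℝ} (hB : ContDiff ℝ ∞ B) (hC : ContDiff ℝ ∞ C)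
    (hBC : ∀ᶠ p in 𝓝 (0 : ℝ × ℝ), HasDerivAt (fun w => B (p.1, w)) (-2 * p.2 * C p) p.2) :
    ∃ G h : ℝ × ℝ → ℝ, ContDiff ℝ ∞ G ∧ ContDiff ℝ ∞ h ∧
      (∀ᶠ p in 𝓝 (0 : ℝ × ℝ), B p = G (p.1, p.2 ^ 2) + p.2 ^ 3 * h (p.1, p.2 ^ 2)) ∧
      ∀ᶠ u in 𝓝 (0 : ℝ), h (u, 0) = -(2 / 3) * fderiv ℝ C (u, 0) (0, 1) := by
  obtain ⟨e, o, he, ho, hCeo⟩ := exists_even_add_odd hC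
  have hI : ∀ {k : ℝ × ℝ → ℝ} (n : ℕ), ContDiff ℝ ∞ k → ContDiff ℝ ∞
      (fun p : ℝ × ℝ => ∫ r in (0 : ℝ)..1, r ^ n * k (p.1, r ^ 2 * p.2)) := fun {k} n hk =>
    ContDiff.parametric_integral_zero_one
      (F := fun q : (ℝ × ℝ) × ℝ => q.2 ^ n * k (q.1.1, q.2 ^ 2 * q.1.2)) (by fun_prop)
  have ho' : ∀ᶠ u in 𝓝 (0 : ℝ), o (u, 0) = fderiv ℝ C (u, 0) (0, 1) := by
    have hc : ContinuousAt (fun u : ℝ => ((u, 0) : ℝ × ℝ)) 0 := by fun_prop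
    filter_upwards [hc.eventually hCeo.eventually_nhds] with u hu
    have h₁ := hasDerivAt_prodMk_right_of_contDiff hC u 0
    have hsq : HasDerivAt (fun w : ℝ => w ^ 2) 0 0 := by simpa using hasDerivAt_pow 2 (0 : ℝ)
    have q : ∀ {k : ℝ × ℝ → ℝ}, ContDiff ℝ ∞ k → HasDerivAt (fun w => k (u, w ^ 2)) 0 0 := by
      intro k hk
      have : HasDerivAt (fun w => k (u, w)) (fderiv ℝ k (u, 0) (0, 1)) ((0 : ℝ) ^ 2) := by
        simpa using hasDerivAt_prodMk_right_of_contDiff hk u 0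
      simpa [Function.comp_def] using HasDerivAt.comp (h := fun w : ℝ => w ^ 2) 0 this hsq
    have h₂ : HasDerivAt (fun w => e (u, w ^ 2) + w * o (u, w ^ 2)) (o (u, 0)) 0 := by
      refine ((q he).add ((hasDerivAt_id (0 : ℝ)).mul (q ho))).congr_deriv ?_
      simp
    have hcw : ContinuousAt (fun w : ℝ => ((u, w) : ℝ × ℝ)) 0 := by fun_prop
    exact h₂.unique (h₁.congr_of_eventuallyEq ((hcw.eventually hu).mono fun w hw => hw.symm))
  refine ⟨fun p => B (p.1, 0) + -2 * p.2 * ∫ r in (0 : ℝ)..1, r ^ 1 * e (p.1, r ^ 2 * p.2),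
    fun p => -2 * ∫ r in (0 : ℝ)..1, r ^ 2 * o (p.1, r ^ 2 * p.2), ?_, ?_, ?_, ?_⟩
  · have := hI 1 he
    fun_prop
  · have := hI 2 ho
    fun_prop
  · obtain ⟨ε, hε, hball⟩ := Metric.eventually_nhds_iff_ball.1 (hBC.and hCeo)
    filter_upwards [Metric.ball_mem_nhds (0 : ℝ × ℝ) hε] with p hp
    obtain ⟨u, w⟩ := p
    have hmem : ∀ r ∈ Icc (0 : ℝ) 1, (u, r * w) ∈ Metric.ball (0 : ℝ × ℝ) ε := by
      intro r hr
      simp only [Metric.mem_ball, dist_zero_right, Prod.norm_mk, Real.norm_eq_abs,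
        max_lt_iff] at hp ⊢
      refine ⟨hp.1, ?_⟩
      rw [abs_mul, abs_of_nonneg hr.1]
      exact (mul_le_of_le_one_left (abs_nonneg w) hr.2).trans_lt hp.2
    have hder : ∀ r ∈ uIcc (0 : ℝ) 1, HasDerivAt (fun r => B (u, r * w))
        (-2 * w ^ 2 * (r ^ 1 * e (u, r ^ 2 * w ^ 2)) + -2 * w ^ 3 * (r ^ 2 * o (u, r ^ 2 * w ^ 2)))
        r := by
      intro r hr
      rw [uIcc_of_le zero_le_one] at hr
      obtain ⟨h₁, h₂⟩ := hball _ (hmem r hr)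
      refine (HasDerivAt.comp r h₁ ((hasDerivAt_id r).mul_const w)).congr_deriv ?_
      rw [h₂]
      dsimp only
      rw [mul_pow]
      ring
    have c₁ : Continuous fun r : ℝ => r ^ 1 * e (u, r ^ 2 * w ^ 2) := by fun_prop
    have c₂ : Continuous fun r : ℝ => r ^ 2 * o (u, r ^ 2 * w ^ 2) := by fun_prop
    have ftc := intervalIntegral.integral_eq_sub_of_hasDerivAt hder
      (Continuous.intervalIntegrable (by fun_prop) _ _)
    rw [intervalIntegral.integral_add (Continuous.intervalIntegrable (by fun_prop) _ _)
      (Continuous.intervalIntegrable (by fun_prop) _ _), intervalIntegral.integral_const_mul,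
      intervalIntegral.integral_const_mul, one_mul, zero_mul] at ftc
    dsimp only
    linarith
  · filter_upwards [ho'] with u hu
    simp only [mul_zero, intervalIntegral.integral_mul_const, integral_pow, hu]
    norm_num
    ring

lemma germEquiv_cuspidalCrossCap_of_hasDerivAt {B C : ℝ × ℝ → ℝ} (hB : ContDiff ℝ ∞ B)
    (hC : ContDiff ℝ ∞ C)
    (hBC : ∀ᶠ p in 𝓝 (0 : ℝ × ℝ), HasDerivAt (fun w => B (p.1, w)) (-2 * p.2 * C p) p.2)
    (h0 : fderiv ℝ C (0, 0) (0, 1) = 0) {κ : ℝ} (hκ : κ ≠ 0)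
    (h1 : HasDerivAt (fun u => fderiv ℝ C (u, 0) (0, 1)) κ 0) :
    GermEquiv (fun p : ℝ × ℝ => (p.1, p.2 ^ 2, B p)) (0, 0) cuspidalCrossCap (0, 0) := by
  obtain ⟨G, h, hG, hh, e, e'⟩ := exists_even_add_cube_mul hB hC hBC
  refine germEquiv_cuspidalCrossCap_of_eq hG hh e (by rw [e'.self_of_nhds, h0, mul_zero])
    (κ := -(2 / 3) * κ) (by simpa using hκ) ?_
  exact (h1.const_mul (-(2 / 3))).congr_of_eventuallyEq e'

lemma Filter.EventuallyEq.eventuallyEq_of_hasDerivAt {F G F' G' : ℝ → ℝ} {a : ℝ} (h : F =ᶠ[𝓝 a] G)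
    (hF : ∀ᶠ t in 𝓝 a, HasDerivAt F (F' t) t) (hG : ∀ᶠ t in 𝓝 a, HasDerivAt G (G' t) t) :
    F' =ᶠ[𝓝 a] G' := by
  filter_upwards [h.eventually_nhds, hF, hG] with t ht h₁ h₂
  exact h₁.unique (h₂.congr_of_eventuallyEq ht)

lemma ContDiff.deriv_of_infty {F : Type*} [NormedAddCommGroup F] [NormedSpace ℝ F] {Y : ℝ → F}
    (h : ContDiff ℝ ∞ Y) : ContDiff ℝ ∞ (deriv Y) :=
  (contDiff_infty_iff_deriv.1 h).2

lemma ContDiff.hasDerivAt_deriv {F : Type*} [NormedAddCommGroup F] [NormedSpace ℝ F] {Y : ℝ → F}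
    (h : ContDiff ℝ ∞ Y) (t : ℝ) : HasDerivAt Y (deriv Y t) t :=
  ((h.differentiable (by simp)) t).hasDerivAt

/-- The point at signed horizontal distance `u - t` on the tangent line to the graph of `Y`. -/
noncomputable def tangentGraph (Y : ℝ → ℝ) (p : ℝ × ℝ) : ℝ := Y p.2 + (p.1 - p.2) * deriv Y p.2

lemma tangentGraph_contDiff {Y : ℝ → ℝ} (hY : ContDiff ℝ ∞ Y) : ContDiff ℝ ∞ (tangentGraph Y) := by
  have := hY.deriv_of_infty
  unfold tangentGraph
  fun_prop

lemma tangentGraph_hasDerivAt {Y : ℝ → ℝ} (hY : ContDiff ℝ ∞ Y) (u t : ℝ) :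
    HasDerivAt (fun t => tangentGraph Y (u, t)) ((u - t) * deriv (deriv Y) t) t := by
  refine ((hY.hasDerivAt_deriv t).add (((hasDerivAt_id t).const_sub u).mul
    (hY.deriv_of_infty.hasDerivAt_deriv t))).congr_deriv ?_
  simp

/-- Near a point where `Y'' > 0`, the graph minus its tangent line is a square. -/
lemma exists_sub_tangentGraph_eq_sq {Y : ℝ → ℝ} (hY : ContDiff ℝ ∞ Y)
    (h2 : 0 < deriv (deriv Y) 0) : ∃ q : ℝ × ℝ → ℝ, ContDiff ℝ ∞ q ∧ q (0, 0) ≠ 0 ∧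
      ∀ᶠ p in 𝓝 (0 : ℝ × ℝ), Y p.1 - tangentGraph Y p = ((p.2 - p.1) * q p) ^ 2 := by
  have hY2 := hY.deriv_of_infty.deriv_of_infty
  let k : ℝ × ℝ → ℝ := fun p => ∫ r in (0 : ℝ)..1, r * deriv (deriv Y) (p.1 + r * (p.2 - p.1))
  have hk : ContDiff ℝ ∞ k := ContDiff.parametric_integral_zero_one
    (F := fun x : (ℝ × ℝ) × ℝ => x.2 * deriv (deriv Y) (x.1.1 + x.2 * (x.1.2 - x.1.1))) (by fun_prop)
  have hk0 : 0 < k 0 := by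
    have : k 0 = deriv (deriv Y) 0 / 2 := by
      simp [k, intervalIntegral.integral_mul_const]
      ring
    rw [this]
    positivity
  have hpos : ∀ᶠ p in 𝓝 (0 : ℝ × ℝ), 0 < k p := hk.continuous.continuousAt.eventually (lt_mem_nhds hk0)
  obtain ⟨q, hq, hqk⟩ := exists_contDiff_eventuallyEq (f := fun p => √(k p)) (p := 0)
    (hpos.mono fun p hp => hk.contDiffAt.sqrt hp.ne')
  refine ⟨q, hq, ?_, ?_⟩
  · have : q 0 = √(k 0) := hqk.self_of_nhds
    change q 0 ≠ 0
    rw [this]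
    positivity
  · filter_upwards [hpos, hqk] with p hp hqp
    obtain ⟨u, t⟩ := p
    rw [mul_pow, hqp, Real.sq_sqrt hp.le]
    have hder : ∀ r ∈ uIcc (0 : ℝ) 1, HasDerivAt (fun r => tangentGraph Y (u, u + r * (t - u)))
        (-(t - u) ^ 2 * (r * deriv (deriv Y) (u + r * (t - u)))) r := by
      intro r _
      refine (HasDerivAt.comp r (tangentGraph_hasDerivAt hY u (u + r * (t - u)))
        (((hasDerivAt_id r).mul_const (t - u)).const_add u)).congr_deriv ?_
      ring
    have ftc := intervalIntegral.integral_eq_sub_of_hasDerivAt hder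
      (Continuous.intervalIntegrable (by fun_prop) _ _)
    rw [intervalIntegral.integral_const_mul, one_mul, zero_mul] at ftc
    have hu : tangentGraph Y (u, u + 0) = Y u := by simp [tangentGraph]
    rw [hu, add_sub_cancel] at ftc
    simp only [k]
    linarith

/-- The tangent surface of the graph `u ↦ (u, Y u, Z u)` is a cuspidal cross cap. -/
lemma germEquiv_cuspidalCrossCap_of_graph {Y Z : ℝ → ℝ} (hY : ContDiff ℝ ∞ Y) (hZ : ContDiff ℝ ∞ Z)
    (hY2 : 0 < deriv (deriv Y) 0) (hZ2 : deriv (deriv Z) 0 = 0) (hZ3 : deriv (deriv (deriv Z)) 0 = 0)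
    (hZ4 : deriv (deriv (deriv (deriv Z))) 0 ≠ 0) :
    GermEquiv (fun p : ℝ × ℝ => (p.1, tangentGraph Y p, tangentGraph Z p)) (0, 0)
      cuspidalCrossCap (0, 0) := by
  obtain ⟨q, hq, hq0, hsq⟩ := exists_sub_tangentGraph_eq_sq hY hY2
  let σ : ℝ × ℝ → ℝ × ℝ := fun p => (p.1, (p.2 - p.1) * q p)
  have hσs : ContDiff ℝ ∞ σ := by fun_prop
  have hσ0 : σ 0 = 0 := by simp [σ]
  have hσ : IsDiffeoGerm σ 0 := by
    have hqd := ((hq.differentiable (by simp)) 0).hasFDerivAt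
    refine .of_injective hσs (hasFDerivAt_fst.prodMk
      ((hasFDerivAt_snd.sub hasFDerivAt_fst).mul hqd)) ?_ rfl
    rintro ⟨a, b⟩ hab
    have : q 0 ≠ 0 := hq0
    simp only [ContinuousLinearMap.prod_apply, ContinuousLinearMap.coe_fst', Prod.mk_eq_zero,
      smul_apply, Prod.fst_zero, Prod.snd_zero, sub_self, zero_smul, zero_add,
      sub_apply, ContinuousLinearMap.coe_snd', smul_eq_mul, mul_eq_zero, this, false_or] at hab
    obtain ⟨rfl, h⟩ := hab
    simpa using h
  obtain ⟨σi, hσi, hσi0, hl, hr⟩ := hσ.exists_inverse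
  rw [hσ0] at hσi0 hr
  let θ : ℝ × ℝ → ℝ := fun p => (σi p).2
  have hθ : ContDiff ℝ ∞ θ := hσi.snd
  have hθ0 : θ 0 = 0 := by simp [θ, hσi0]
  have hθc : ContinuousAt θ 0 := hθ.continuous.continuousAt
  have hθl : ∀ᶠ p in 𝓝 (0 : ℝ × ℝ), θ (σ p) = p.2 := hl.mono fun p hp => by simp [θ, hp]
  have hθr : ∀ᶠ p in 𝓝 (0 : ℝ × ℝ), (p.1, θ p) = σi p ∧ (θ p - p.1) * q (p.1, θ p) = p.2 := by
    filter_upwards [hr] with p hp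
    have h₁ : (σ (σi p)).1 = p.1 := congrArg Prod.fst hp
    change (σi p).1 = p.1 at h₁
    have h₂ : (p.1, θ p) = σi p := by rw [← h₁]
    refine ⟨h₂, ?_⟩
    rw [h₂, ← h₁]
    exact congrArg Prod.snd hp
  have hθax : ∀ᶠ u in 𝓝 (0 : ℝ), θ (u, 0) = u := by
    have hc : ContinuousAt (fun u : ℝ => ((u, u) : ℝ × ℝ)) 0 := by fun_prop
    filter_upwards [hc.eventually hθl] with u hu
    simpa [σ] using hu
  have hθd : ∀ p : ℝ × ℝ, HasDerivAt (fun w => θ (p.1, w)) (fderiv ℝ θ p (0, 1)) p.2 := fun p =>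
    hasDerivAt_prodMk_right_of_contDiff hθ p.1 p.2
  have hθw : fderiv ℝ θ 0 (0, 1) ≠ 0 := by
    intro h
    have hc : ContinuousAt (fun w : ℝ => ((0, w) : ℝ × ℝ)) 0 := by fun_prop
    have e : (fun w => θ (0, w) * q (0, θ (0, w))) =ᶠ[𝓝 0] fun w => w := by
      filter_upwards [hc.eventually hθr] with w hw
      simpa using hw.2
    have hd : HasDerivAt (fun w => θ (0, w)) 0 0 := by
      exact (hθd (0, 0)).congr_deriv h
    have hqθ : HasDerivAt (fun w => q (0, θ (0, w))) (fderiv ℝ q (0, θ (0, 0)) (0, 1) * 0) 0 :=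
      HasDerivAt.comp (h := fun w => θ (0, w)) 0
        (hasDerivAt_prodMk_right_of_contDiff hq 0 (θ (0, 0))) hd
    have := ((hd.mul hqθ).congr_of_eventuallyEq e.symm).unique (hasDerivAt_id 0)
    simp at this
  have hY2s := hY.deriv_of_infty.deriv_of_infty
  have hZ2s := hZ.deriv_of_infty.deriv_of_infty
  have hY2ne : ∀ᶠ t in 𝓝 (0 : ℝ), deriv (deriv Y) t ≠ 0 :=
    hY2s.continuous.continuousAt.eventually_ne hY2.ne'
  obtain ⟨c, hc, hcq⟩ := exists_contDiff_eventuallyEq (p := 0)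
    (f := fun t => deriv (deriv Z) t / deriv (deriv Y) t)
    (hY2ne.mono fun t ht => hZ2s.contDiffAt.div hY2s.contDiffAt ht)
  have e₀ : (fun t => c t * deriv (deriv Y) t) =ᶠ[𝓝 0] deriv (deriv Z) := by
    filter_upwards [hcq, hY2ne] with t ht ht'
    rw [ht]
    field_simp
  have e₁ := e₀.eventuallyEq_of_hasDerivAt
    (Eventually.of_forall fun t => (hc.hasDerivAt_deriv t).mul (hY2s.hasDerivAt_deriv t))
    (Eventually.of_forall hZ2s.hasDerivAt_deriv)
  have e₂ := e₁.eventuallyEq_of_hasDerivAt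
    (Eventually.of_forall fun t =>
      ((hc.deriv_of_infty.hasDerivAt_deriv t).mul (hY2s.hasDerivAt_deriv t)).add
      ((hc.hasDerivAt_deriv t).mul (hY2s.deriv_of_infty.hasDerivAt_deriv t)))
    (Eventually.of_forall hZ2s.deriv_of_infty.hasDerivAt_deriv)
  have hc0 : c 0 = 0 := by
    have := e₀.self_of_nhds
    simpa [hZ2, hY2.ne'] using this
  have hc1 : deriv c 0 = 0 := by
    have := e₁.self_of_nhds
    simpa [hZ3, hY2.ne', hc0] using this
  have hc2 : deriv (deriv c) 0 ≠ 0 := by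
    intro h
    have := e₂.self_of_nhds
    simp [h, hc0, hc1] at this
    exact hZ4 this.symm
  let B : ℝ × ℝ → ℝ := fun p => tangentGraph Z (p.1, θ p)
  have hCd : ∀ u, fderiv ℝ (fun p => c (θ p)) (u, 0) (0, 1) =
      deriv c (θ (u, 0)) * fderiv ℝ θ (u, 0) (0, 1) := fun u =>
    (hasDerivAt_prodMk_right_of_contDiff (hc.comp hθ) u 0).unique
      ((hc.hasDerivAt_deriv (θ (u, 0))).comp 0 (hθd (u, 0)))
  have hfold : GermEquiv (fun p : ℝ × ℝ => (p.1, p.2 ^ 2, B p)) (0, 0) cuspidalCrossCap (0, 0) := by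
    have hZt := tangentGraph_contDiff hZ
    refine germEquiv_cuspidalCrossCap_of_hasDerivAt (C := fun p => c (θ p))
      (κ := deriv (deriv c) 0 * fderiv ℝ θ 0 (0, 1)) (by fun_prop) (by fun_prop) ?_ ?_
      (mul_ne_zero hc2 hθw) ?_
    · have hYY : ∀ᶠ p in 𝓝 (0 : ℝ × ℝ), Y p.1 - tangentGraph Y (p.1, θ p) = p.2 ^ 2 := by
        have ht : Tendsto σi (𝓝 0) (𝓝 0) := by
          simpa [hσi0] using hσi.continuous.tendsto 0
        filter_upwards [ht.eventually hsq, hθr] with p hp hp'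
        rw [← hp'.1] at hp
        rw [hp, hp'.2]
      have hcθ : ∀ᶠ p in 𝓝 (0 : ℝ × ℝ), c (θ p) * deriv (deriv Y) (θ p) = deriv (deriv Z) (θ p) := by
        rw [← hθ0] at e₀
        exact hθc.eventually e₀
      filter_upwards [hYY.eventually_nhds, hcθ] with p hp hcp
      have hline : ContinuousAt (fun w : ℝ => ((p.1, w) : ℝ × ℝ)) p.2 := by fun_prop
      have h₁ : HasDerivAt (fun w => tangentGraph Y (p.1, θ (p.1, w)))
          ((p.1 - θ p) * deriv (deriv Y) (θ p) * fderiv ℝ θ p (0, 1)) p.2 :=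
        HasDerivAt.comp (h := fun w => θ (p.1, w)) p.2 (tangentGraph_hasDerivAt hY p.1 (θ p)) (hθd p)
      have h₂ : HasDerivAt (fun w => tangentGraph Z (p.1, θ (p.1, w)))
          ((p.1 - θ p) * deriv (deriv Z) (θ p) * fderiv ℝ θ p (0, 1)) p.2 :=
        HasDerivAt.comp (h := fun w => θ (p.1, w)) p.2 (tangentGraph_hasDerivAt hZ p.1 (θ p)) (hθd p)
      have h₃ : -((p.1 - θ p) * deriv (deriv Y) (θ p) * fderiv ℝ θ p (0, 1)) = 2 * p.2 := by
        have e : (fun w => Y p.1 - tangentGraph Y (p.1, θ (p.1, w))) =ᶠ[𝓝 p.2] fun w => w ^ 2 :=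
          hline.eventually hp
        have := ((h₁.const_sub (Y p.1)).congr_of_eventuallyEq e.symm).unique (hasDerivAt_pow 2 p.2)
        simpa using this
      refine h₂.congr_deriv ?_
      rw [← hcp]
      linear_combination (-c (θ p)) * h₃
    · rw [hCd]
      have : θ (0, 0) = 0 := hθ0
      simp [this, hc1]
    · have e : (fun u => fderiv ℝ (fun p => c (θ p)) (u, 0) (0, 1)) =ᶠ[𝓝 0]
          fun u => deriv c u * fderiv ℝ θ (u, 0) (0, 1) := by
        filter_upwards [hθax] with u hu
        rw [hCd, hu]
      have hθ' : ContDiff ℝ ∞ (fun p => fderiv ℝ θ p (0, 1)) :=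
        (hθ.fderiv_right (m := ∞) (by simp)).clm_apply contDiff_const
      refine HasDerivAt.congr_of_eventuallyEq (((hc.deriv_of_infty.hasDerivAt_deriv 0).mul
        (hasDerivAt_prodMk_left_of_contDiff hθ' 0 0)).congr_deriv ?_) e
      rw [hc1, zero_mul, add_zero]
      rfl
  refine GermEquiv.trans ⟨σ, fun v => (v.1, Y v.1 - v.2.1, v.2.2), hσ, hσ0, ?_, ?_⟩ hfold
  · exact .of_leftInverse (σi := fun v => (v.1, Y v.1 - v.2.1, v.2.2)) (by fun_prop) (by fun_prop)
      (fun v => by simp) rfl _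
  · filter_upwards [hsq, hθl] with p hp hp'
    simp only [B, hp']
    simp [σ, hp]

/-- In coordinates adapted to the curve, the tangent surface of `t ↦ (x t, y t, z t)` is a cuspidal
cross cap. -/
lemma germEquiv_cuspidalCrossCap_of_curve {x y z : ℝ → ℝ} {t₀ : ℝ} (hx : ContDiff ℝ ∞ x)
    (hy : ContDiff ℝ ∞ y) (hz : ContDiff ℝ ∞ z) (hx0 : x t₀ = 0) (hx1 : deriv x t₀ = 1)
    (hy1 : deriv y t₀ = 0) (hy2 : deriv (deriv y) t₀ = 1) (hz1 : deriv z t₀ = 0)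
    (hz2 : deriv (deriv z) t₀ = 0) (hz3 : deriv (deriv (deriv z)) t₀ = 0)
    (hz4 : deriv (deriv (deriv (deriv z))) t₀ = 1) :
    GermEquiv (fun p : ℝ × ℝ => (x p.1 + p.2 * deriv x p.1, y p.1 + p.2 * deriv y p.1,
      z p.1 + p.2 * deriv z p.1)) (t₀, 0) cuspidalCrossCap (0, 0) := by
  have hxd : IsDiffeoGerm x t₀ := .of_injective hx (hx.hasDerivAt_deriv t₀).hasFDerivAt
    (fun v hv => by simpa [hx1] using hv) rfl
  obtain ⟨φ, hφ, -, hl, -⟩ := hxd.exists_inverse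
  have hx' := hx.deriv_of_infty
  have hx'' := hx'.deriv_of_infty
  have hx''' := hx''.deriv_of_infty
  have step : ∀ {Y : ℝ → ℝ}, ContDiff ℝ ∞ Y → ∀ t,
      HasDerivAt (fun t => Y (x t)) (deriv Y (x t) * deriv x t) t := fun hY t =>
    HasDerivAt.comp t (hY.hasDerivAt_deriv (x t)) (hx.hasDerivAt_deriv t)
  have d0 : ∀ {y : ℝ → ℝ}, (fun t => y (φ (x t))) =ᶠ[𝓝 t₀] y := fun {y} =>
    hl.mono fun t ht => congrArg y ht
  have d1 : ∀ {y : ℝ → ℝ}, ContDiff ℝ ∞ y →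
      (fun t => deriv (fun u => y (φ u)) (x t) * deriv x t) =ᶠ[𝓝 t₀] deriv y := fun hy =>
    d0.eventuallyEq_of_hasDerivAt (Eventually.of_forall (step (hy.comp hφ)))
      (Eventually.of_forall hy.hasDerivAt_deriv)
  have d2 : ∀ {y : ℝ → ℝ}, ContDiff ℝ ∞ y →
      (fun t => deriv (deriv fun u => y (φ u)) (x t) * deriv x t * deriv x t +
        deriv (fun u => y (φ u)) (x t) * deriv (deriv x) t) =ᶠ[𝓝 t₀] deriv (deriv y) := fun hy =>
    (d1 hy).eventuallyEq_of_hasDerivAt (Eventually.of_forall fun t =>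
        (step (hy.comp hφ).deriv_of_infty t).mul (hx'.hasDerivAt_deriv t))
      (Eventually.of_forall hy.deriv_of_infty.hasDerivAt_deriv)
  let Y : ℝ → ℝ := fun u => y (φ u)
  let Z : ℝ → ℝ := fun u => z (φ u)
  have hY : ContDiff ℝ ∞ Y := hy.comp hφ
  have hZ : ContDiff ℝ ∞ Z := hz.comp hφ
  have hY1 : deriv Y 0 = 0 := by simpa [hx0, hx1, hy1] using (d1 hy).self_of_nhds
  have hZ1 : deriv Z 0 = 0 := by simpa [hx0, hx1, hz1] using (d1 hz).self_of_nhds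
  have hY2 : deriv (deriv Y) 0 = 1 := by
    have := (d2 hy).self_of_nhds
    change deriv (deriv Y) (x t₀) * deriv x t₀ * deriv x t₀ + deriv Y (x t₀) * deriv (deriv x) t₀ = _
      at this
    simpa [hx0, hx1, hy2, hY1] using this
  have hZ2 : deriv (deriv Z) 0 = 0 := by
    have := (d2 hz).self_of_nhds
    change deriv (deriv Z) (x t₀) * deriv x t₀ * deriv x t₀ + deriv Z (x t₀) * deriv (deriv x) t₀ = _
      at this
    simpa [hx0, hx1, hz2, hZ1] using this
  have hZ' := hZ.deriv_of_infty
  have hZ'' := hZ'.deriv_of_infty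
  have d3 := (d2 hz).eventuallyEq_of_hasDerivAt (Eventually.of_forall fun t =>
      (((step hZ'' t).mul (hx'.hasDerivAt_deriv t)).mul (hx'.hasDerivAt_deriv t)).add
      ((step hZ' t).mul (hx''.hasDerivAt_deriv t)))
      (Eventually.of_forall hz.deriv_of_infty.deriv_of_infty.hasDerivAt_deriv)
  have hZ3 : deriv (deriv (deriv Z)) 0 = 0 := by
    simpa [hx0, hx1, hz3, hZ1, hZ2] using d3.self_of_nhds
  have d4 := d3.eventuallyEq_of_hasDerivAt (Eventually.of_forall fun t =>
      ((((((step hZ''.deriv_of_infty t).mul (hx'.hasDerivAt_deriv t)).mul (hx'.hasDerivAt_deriv t)).add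
        ((step hZ'' t).mul (hx''.hasDerivAt_deriv t))).mul (hx'.hasDerivAt_deriv t)).add
        (((step hZ'' t).mul (hx'.hasDerivAt_deriv t)).mul (hx''.hasDerivAt_deriv t))).add
      ((((step hZ'' t).mul (hx'.hasDerivAt_deriv t)).mul (hx''.hasDerivAt_deriv t)).add
        ((step hZ' t).mul (hx'''.hasDerivAt_deriv t))))
      (Eventually.of_forall hz.deriv_of_infty.deriv_of_infty.deriv_of_infty.hasDerivAt_deriv)
  have hZ4 : deriv (deriv (deriv (deriv Z))) 0 = 1 := by
    simpa [hx0, hx1, hz4, hZ1, hZ2, hZ3] using d4.self_of_nhds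
  refine GermEquiv.trans ⟨fun p => (x p.1 + p.2 * deriv x p.1, x p.1), id, ?_, by simp [hx0], ?_, ?_⟩
    (germEquiv_cuspidalCrossCap_of_graph hY hZ (by rw [hY2]; exact one_pos) hZ2 hZ3
      (by rw [hZ4]; exact one_ne_zero))
  · have h : ∀ {x : ℝ → ℝ}, ContDiff ℝ ∞ x → HasFDerivAt (fun p : ℝ × ℝ => x p.1)
        (deriv x t₀ • ContinuousLinearMap.fst ℝ ℝ ℝ) (t₀, 0) := fun hx =>
      (hx.hasDerivAt_deriv t₀).comp_hasFDerivAt (t₀, (0 : ℝ)) hasFDerivAt_fst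
    refine .of_injective (by fun_prop) (((h hx).add (hasFDerivAt_snd.mul (h hx'))).prodMk (h hx)) ?_ rfl
    rintro ⟨a, b⟩ hab
    simp [hx1] at hab
    obtain ⟨h, rfl⟩ := hab
    simpa using h
  · exact .of_leftInverse (σi := id) contDiff_id contDiff_id (fun _ => rfl) rfl _
  · have hc : ContinuousAt (fun p : ℝ × ℝ => p.1) (t₀, 0) := by fun_prop
    filter_upwards [hc.eventually (d0 (y := y)), hc.eventually (d0 (y := z)), hc.eventually (d1 hy),
      hc.eventually (d1 hz)] with p h₁ h₂ h₃ h₄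
    simp only [tangentGraph, id, Prod.mk.injEq, true_and]
    change Y (x p.1) = y p.1 at h₁
    change Z (x p.1) = z p.1 at h₂
    rw [h₁, h₂, ← h₃, ← h₄]
    constructor <;> ring

/-- if `γ'(t₀), γ''(t₀), γ'''(t₀)` are linearly dependent but
`γ'(t₀), γ''(t₀), γ''''(t₀)` are linearly independent, then the tangent surface
`f(t,s) = γ(t) + sγ'(t)`, as a germ at `(t₀,0)`, is diffeomorphic to the folded
umbrella `(u,t) ↦ (u, t²+ut, t⁴+(2/3)ut³)`. -/
theorem stmt11 (γ : ℝ → Fin 3 → ℝ) (hγ : ContDiff ℝ (⊤ : ℕ∞) γ) (t₀ : ℝ)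
    (hdep : ¬ LinearIndependent ℝ
      ![deriv γ t₀, iteratedDeriv 2 γ t₀, iteratedDeriv 3 γ t₀])
    (hindep : LinearIndependent ℝ
      ![deriv γ t₀, iteratedDeriv 2 γ t₀, iteratedDeriv 4 γ t₀])
    (f : ℝ × ℝ → Fin 3 → ℝ) (hf : f = fun p => γ p.1 + p.2 • deriv γ p.1)
    (g : ℝ × ℝ → Fin 3 → ℝ)
    (hg : g = fun p => ![p.1, p.2 ^ 2 + p.1 * p.2, p.2 ^ 4 + (2 / 3) * p.1 * p.2 ^ 3]) :
    LocallyDiffeomorphic f (t₀, 0) g (0, 0) := by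
  subst hf hg
  let b := basisOfLinearIndependentOfCardEqFinrank hindep (by simp)
  let ℓ : Fin 3 → (Fin 3 → ℝ) →L[ℝ] ℝ := fun i => (b.coord i).toContinuousLinearMap
  have hℓ : ∀ i j, ℓ i (![deriv γ t₀, iteratedDeriv 2 γ t₀, iteratedDeriv 4 γ t₀] j) =
      if j = i then 1 else 0 := fun i j => by
    have : ![deriv γ t₀, iteratedDeriv 2 γ t₀, iteratedDeriv 4 γ t₀] j = b j := by simp [b]
    rw [this]
    simp [ℓ, Finsupp.single_apply]
  have hγ' := hγ.deriv_of_infty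
  have hγ'' := hγ'.deriv_of_infty
  have hγ''' := hγ''.deriv_of_infty
  have e2 : iteratedDeriv 2 γ = deriv (deriv γ) := by simp [iteratedDeriv_succ]
  have e3 : iteratedDeriv 3 γ = deriv (deriv (deriv γ)) := by simp [iteratedDeriv_succ]
  have e4 : iteratedDeriv 4 γ = deriv (deriv (deriv (deriv γ))) := by simp [iteratedDeriv_succ]
  have h3 : ℓ 2 (iteratedDeriv 3 γ t₀) = 0 := by
    by_contra h
    refine hdep (Fintype.linearIndependent_iff.2 fun a ha => ?_)
    simp only [Fin.sum_univ_three, Matrix.cons_val_zero, Matrix.cons_val_one,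
      Matrix.cons_val] at ha
    have k : ∀ i, a 0 * ℓ i (deriv γ t₀) + a 1 * ℓ i (iteratedDeriv 2 γ t₀) +
        a 2 * ℓ i (iteratedDeriv 3 γ t₀) = 0 := fun i => by
      simpa using congrArg (ℓ i) ha
    have p0 : ∀ i, ℓ i (deriv γ t₀) = if 0 = i then 1 else 0 := fun i => hℓ i 0
    have p1 : ∀ i, ℓ i (iteratedDeriv 2 γ t₀) = if 1 = i then 1 else 0 := fun i => hℓ i 1
    have a2 : a 2 = 0 := by simpa [p0, p1, h] using k 2
    have a1 : a 1 = 0 := by simpa [p0, p1, a2] using k 1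
    have a0 : a 0 = 0 := by simpa [p0, p1, a2] using k 0
    intro i
    fin_cases i
    exacts [a0, a1, a2]
  have hd : ∀ i {c : ℝ → Fin 3 → ℝ}, ContDiff ℝ ∞ c →
      deriv (fun t => ℓ i (c t)) = fun t => ℓ i (deriv c t) := fun i c hc =>
    funext fun t => ((ℓ i).hasFDerivAt.comp_hasDerivAt t (hc.hasDerivAt_deriv t)).deriv
  let c : Fin 3 → ℝ → ℝ := fun i t => ℓ i (γ t - γ t₀)
  have hc : ∀ i, ContDiff ℝ ∞ (c i) := fun i => (ℓ i).contDiff.comp (hγ.sub contDiff_const)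
  have c1 : ∀ i, deriv (c i) = fun t => ℓ i (deriv γ t) := fun i =>
    funext fun t => ((ℓ i).hasFDerivAt.comp_hasDerivAt t
      ((hγ.hasDerivAt_deriv t).sub_const (γ t₀))).deriv
  have c2 : ∀ i, deriv (deriv (c i)) = fun t => ℓ i (deriv (deriv γ) t) := fun i => by
    rw [c1, hd i hγ']
  have c3 : ∀ i, deriv (deriv (deriv (c i))) = fun t => ℓ i (deriv (deriv (deriv γ)) t) := fun i => by
    rw [c2, hd i hγ'']
  have c4 : ∀ i, deriv (deriv (deriv (deriv (c i)))) =
      fun t => ℓ i (deriv (deriv (deriv (deriv γ))) t) := fun i => by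
    rw [c3, hd i hγ''']
  have hci : ∀ i t s, c i t + s * deriv (c i) t = ℓ i (γ t + s • deriv γ t - γ t₀) := fun i t s => by
    rw [c1]
    simp only [c, map_sub, map_add, map_smul, smul_eq_mul]
    ring
  rw [e3] at h3
  rw [e2, e4] at hℓ
  have hcurve := germEquiv_cuspidalCrossCap_of_curve (t₀ := t₀) (hc 0) (hc 1) (hc 2) (by simp [c])
    (by simpa [c1] using hℓ 0 0) (by simpa [c1] using hℓ 1 0) (by simpa [c2] using hℓ 1 1)
    (by simpa [c1] using hℓ 2 0) (by simpa [c2] using hℓ 2 1) (by simpa [c3] using h3)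
    (by simpa [c4] using hℓ 2 2)
  let L : (Fin 3 → ℝ) →L[ℝ] ℝ × ℝ × ℝ := (ℓ 0).prod ((ℓ 1).prod (ℓ 2))
  have hL : GermEquiv (fun p : ℝ × ℝ => γ p.1 + p.2 • deriv γ p.1) (t₀, 0)
      (fun p : ℝ × ℝ => (c 0 p.1 + p.2 * deriv (c 0) p.1, c 1 p.1 + p.2 * deriv (c 1) p.1,
        c 2 p.1 + p.2 * deriv (c 2) p.1)) (t₀, 0) := by
    refine ⟨id, fun v => L (v - γ t₀), ?_, rfl, ?_, Eventually.of_forall fun p => ?_⟩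
    · exact .of_leftInverse (σi := id) contDiff_id contDiff_id (fun _ => rfl) rfl _
    · refine .of_injective (by fun_prop) (L.hasFDerivAt.comp _ ((hasFDerivAt_id _).sub_const _))
        (fun v hv => ?_) (by simp)
      have hv' : ℓ 0 v = 0 ∧ ℓ 1 v = 0 ∧ ℓ 2 v = 0 := by simpa [L] using hv
      refine b.ext_elem fun i => ?_
      fin_cases i
      · simpa [ℓ] using hv'.1
      · simpa [ℓ] using hv'.2.1
      · simpa [ℓ] using hv'.2.2
    · simp only [hci, id]
      rfl
  refine ((hL.trans hcurve).trans cuspidalCrossCap_germEquiv_foldedUmbrella).locallyDiffeomorphic ?_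
  have := hγ.continuous
  have := hγ'.continuous
  fun_prop
end
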